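/- arXiv:1601.00999 — 2 statements merged into one kernel-verified Lean document; each statement's English description precedes it below -/
import Mathlib

section
/- Let α ∈ R_g with u(α(1)) > 0, and suppose c > 0 is such that |α'(t)|_g ≥ c for almost every t ∈ [0,1] and v(α(t)) ≥ c(1−t) for all t ∈ [0,1]. Fix p ≥ 2. Then there exists a function φ : [0,1) → ℝ, locally Lipschitz, with φ(0) = 0 and φ(t) > 0 for every t ∈ (0,1), such that (∫₀¹ |φ'|^p F_α |α'|_g^{1−p} dt) / (∫₀¹ |φ|^p F_α |α'|_g dt) = λ_{1,p}(α). -/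
open Set MeasureTheory Filter Topology

noncomputable section

/-- The closed quarter plane `P`. -/
def Pset : Set (ℝ × ℝ) := {z | 0 ≤ z.1 ∧ 0 ≤ z.2}

/-- The interior `P°` of the quarter plane. -/
def Pint : Set (ℝ × ℝ) := {z | 0 < z.1 ∧ 0 < z.2}

/-- The boundary `∂P` of the quarter plane. -/
def Pbdry : Set (ℝ × ℝ) := {z | (0 ≤ z.1 ∧ 0 ≤ z.2) ∧ (z.1 = 0 ∨ z.2 = 0)}

/-- `F(x,y) = c_n x^(n-1) y^(n-1)`. -/
def Fvol (n : ℕ) (cn : ℝ) (z : ℝ × ℝ) : ℝ := cn * z.1 ^ (n - 1) * z.2 ^ (n - 1)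

/-- Euclidean speed of a curve at `t`, computed with derivatives within `s`. -/
def gSpeedOn (s : Set ℝ) (α : ℝ → ℝ × ℝ) (t : ℝ) : ℝ :=
  Real.sqrt ((derivWithin (fun u => (α u).1) s t) ^ 2 + (derivWithin (fun u => (α u).2) s t) ^ 2)

/-- Euclidean speed of a curve defined on `[0,1]`. -/
def gSpeed (α : ℝ → ℝ × ℝ) : ℝ → ℝ := gSpeedOn (Icc 0 1) α

/-- Euclidean length `L_g` of a curve on `[0,1]`. -/
def Lg (α : ℝ → ℝ × ℝ) : ℝ := ∫ t in (0:ℝ)..1, gSpeed α t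

/-- The `h`-speed `|γ'|_h = F(γ) |γ'|_g`, with derivatives within `s`. -/
def hSpeedOn (n : ℕ) (cn : ℝ) (s : Set ℝ) (α : ℝ → ℝ × ℝ) (t : ℝ) : ℝ :=
  Fvol n cn (α t) * gSpeedOn s α t

/-- The `h`-speed for curves defined on `[0,1)`. -/
def hSpeed (n : ℕ) (cn : ℝ) (α : ℝ → ℝ × ℝ) : ℝ → ℝ := hSpeedOn n cn (Ico 0 1) α

/-- The `h`-length `L_h` of a curve on `[0,1)`. -/
def Lh (n : ℕ) (cn : ℝ) (α : ℝ → ℝ × ℝ) : ℝ := ∫ t in (0:ℝ)..1, hSpeed n cn α t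

/-- Numerator integrand of the `g`-Rayleigh quotient:
`|w'(t)|^p F(α t) |α'(t)|_g^(1-p)`. -/
def numG (n : ℕ) (cn p : ℝ) (s : Set ℝ) (α : ℝ → ℝ × ℝ) (w : ℝ → ℝ) (t : ℝ) : ℝ :=
  |derivWithin w (Icc 0 1) t| ^ p * Fvol n cn (α t) * gSpeedOn s α t ^ (1 - p)

/-- Denominator integrand of the `g`-Rayleigh quotient:
`|w(t)|^p F(α t) |α'(t)|_g`. -/
def denG (n : ℕ) (cn p : ℝ) (s : Set ℝ) (α : ℝ → ℝ × ℝ) (w : ℝ → ℝ) (t : ℝ) : ℝ :=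
  |w t| ^ p * Fvol n cn (α t) * gSpeedOn s α t

/-- First Dirichlet eigenvalue of the `p`-Laplacian along a curve, `g`-form:
infimum of the Rayleigh quotient over Lipschitz test functions on `[0,1]`
vanishing at `0` (with admissible, i.e. integrable with positive denominator,
Rayleigh quotients). -/
def lambdaGOn (n : ℕ) (cn p : ℝ) (s : Set ℝ) (α : ℝ → ℝ × ℝ) : ℝ :=
  sInf {q | ∃ w : ℝ → ℝ, (∃ K, LipschitzOnWith K w (Icc 0 1)) ∧ w 0 = 0 ∧
    IntervalIntegrable (numG n cn p s α w) volume 0 1 ∧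
    IntervalIntegrable (denG n cn p s α w) volume 0 1 ∧
    (0 < ∫ t in (0:ℝ)..1, denG n cn p s α w t) ∧
    q = (∫ t in (0:ℝ)..1, numG n cn p s α w t) / (∫ t in (0:ℝ)..1, denG n cn p s α w t)}

/-- `λ_{1,p}` in the `g`-form for curves on `[0,1]`. -/
def lambdaG (n : ℕ) (cn p : ℝ) (α : ℝ → ℝ × ℝ) : ℝ := lambdaGOn n cn p (Icc 0 1) α

/-- Numerator integrand of the `h`-Rayleigh quotient on `[c,d]`:
`|w'(t)|^p F(γ t)^p |γ'(t)|_h^(1-p)`. -/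
def numH (n : ℕ) (cn p c d : ℝ) (s : Set ℝ) (γ : ℝ → ℝ × ℝ) (w : ℝ → ℝ) (t : ℝ) : ℝ :=
  |derivWithin w (Icc c d) t| ^ p * Fvol n cn (γ t) ^ p * hSpeedOn n cn s γ t ^ (1 - p)

/-- Denominator integrand of the `h`-Rayleigh quotient: `|w(t)|^p |γ'(t)|_h`. -/
def denH (n : ℕ) (cn p : ℝ) (s : Set ℝ) (γ : ℝ → ℝ × ℝ) (w : ℝ → ℝ) (t : ℝ) : ℝ :=
  |w t| ^ p * hSpeedOn n cn s γ t

/-- `λ_{1,p}` in the `h`-form for a curve on `[c,d)`, with test functions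
Lipschitz on `[c,d]` vanishing at `c`. -/
def lambdaHOn (n : ℕ) (cn p c d : ℝ) (s : Set ℝ) (γ : ℝ → ℝ × ℝ) : ℝ :=
  sInf {q | ∃ w : ℝ → ℝ, (∃ K, LipschitzOnWith K w (Icc c d)) ∧ w c = 0 ∧
    IntervalIntegrable (numH n cn p c d s γ w) volume c d ∧
    IntervalIntegrable (denH n cn p s γ w) volume c d ∧
    (0 < ∫ t in c..d, denH n cn p s γ w t) ∧
    q = (∫ t in c..d, numH n cn p c d s γ w t) / (∫ t in c..d, denH n cn p s γ w t)}

/-- `λ_{1,p}` in the `h`-form for curves on `[0,1)`. -/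
def lambdaH (n : ℕ) (cn p : ℝ) (γ : ℝ → ℝ × ℝ) : ℝ :=
  lambdaHOn n cn p 0 1 (Ico 0 1) γ

/-- The class `𝒞` of `C¹` curves from `(x₀,y₀)` to the boundary, with constant
speed, interior image on `[0,1)`, endpoint away from the origin, and meeting the
boundary orthogonally. -/
def MemC (x0 y0 : ℝ) (α : ℝ → ℝ × ℝ) : Prop :=
  ContDiffOn ℝ 1 α (Icc 0 1) ∧
  α 0 = (x0, y0) ∧
  (∀ t ∈ Ico (0:ℝ) 1, α t ∈ Pint) ∧
  α 1 ∈ Pbdry ∧ α 1 ≠ ((0 : ℝ), (0 : ℝ)) ∧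
  (∀ t ∈ Icc (0:ℝ) 1, gSpeed α t = Lg α) ∧
  ((α 1).1 = 0 → derivWithin (fun u => (α u).2) (Icc 0 1) 1 = 0) ∧
  ((α 1).2 = 0 → derivWithin (fun u => (α u).1) (Icc 0 1) 1 = 0)

/-- The Simons cone curve `σ(t) = (1-t)·(R,R)`. -/
def simonsCurve (R : ℝ) : ℝ → ℝ × ℝ := fun t => ((1 - t) * R, (1 - t) * R)

/-- The class `R_h`: locally Lipschitz curves on `[0,1)` with image in `P°`,
starting at `(x₀,y₀)`, with essentially bounded `h`-speed, reaching the collapsed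
boundary point as `t → 1` (i.e. `x(γ t)·y(γ t) → 0`). -/
def MemRh (n : ℕ) (cn x0 y0 : ℝ) (γ : ℝ → ℝ × ℝ) : Prop :=
  γ 0 = (x0, y0) ∧
  (∀ t ∈ Ico (0:ℝ) 1, γ t ∈ Pint) ∧
  (∀ a ∈ Ico (0:ℝ) 1, ∃ K, LipschitzOnWith K γ (Icc 0 a)) ∧
  (∃ M : ℝ, ∀ᵐ t ∂(volume : Measure ℝ), t ∈ Ico (0:ℝ) 1 → hSpeed n cn γ t ≤ M) ∧
  Tendsto (fun t => (γ t).1 * (γ t).2) (𝓝[<] (1:ℝ)) (𝓝 0)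

/-- The class `R_h^+`: continuous curves on `[0,1]` into `P` ending on `∂P`
whose restriction to `[0,1)` belongs to `R_h`. -/
def MemRhPlus (n : ℕ) (cn x0 y0 : ℝ) (α : ℝ → ℝ × ℝ) : Prop :=
  ContinuousOn α (Icc 0 1) ∧ (∀ t ∈ Icc (0:ℝ) 1, α t ∈ Pset) ∧ α 1 ∈ Pbdry ∧
  MemRh n cn x0 y0 α

/-- The class `R_g`: Lipschitz curves on `[0,1]` from `(x₀,y₀)` to `∂P` with
interior image on `[0,1)`. -/
def MemRg (x0 y0 : ℝ) (α : ℝ → ℝ × ℝ) : Prop :=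
  (∃ K, LipschitzOnWith K α (Icc 0 1)) ∧ α 0 = (x0, y0) ∧ α 1 ∈ Pbdry ∧
  ∀ t ∈ Ico (0:ℝ) 1, α t ∈ Pint

/-- The coordinate `u(x,y) = (x² - y²)/2`. -/
def ucoord (z : ℝ × ℝ) : ℝ := (z.1 ^ 2 - z.2 ^ 2) / 2

/-- The coordinate `v(x,y) = xy`. -/
def vcoord (z : ℝ × ℝ) : ℝ := z.1 * z.2

/-- The coordinate `r = √(u² + v²)`. -/
def rcoord (z : ℝ × ℝ) : ℝ := Real.sqrt (ucoord z ^ 2 + vcoord z ^ 2)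

/-- The class `R_g^*`: simple curves in `R_g` with a.e. constant speed,
`u(α(1)) > 0`, and `v(α(t)) ≥ c(1-t)` for some `c > 0`. -/
def MemRgStar (x0 y0 : ℝ) (α : ℝ → ℝ × ℝ) : Prop :=
  MemRg x0 y0 α ∧ InjOn α (Icc 0 1) ∧
  (∀ᵐ t ∂(volume : Measure ℝ), t ∈ Icc (0:ℝ) 1 → gSpeed α t = Lg α) ∧
  0 < ucoord (α 1) ∧
  ∃ c > (0:ℝ), ∀ t ∈ Icc (0:ℝ) 1, c * (1 - t) ≤ vcoord (α t)

/-- A pair of weights on `[0,1]` for which the degenerate Sturm–Liouville problem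
`(A |w'|^(q-1) w')' + λ B |w|^(q-1) w = 0` has bounded inverse. -/
structure WeightPair (q : ℝ) (A B : ℝ → ℝ) (L M : ℝ) : Prop where
  one_le : 1 ≤ q
  measurable_left : Measurable A
  measurable_right : Measurable B
  lip_pos : 0 < L
  left_le : ∀ t ∈ Icc (0:ℝ) 1, A t ≤ M
  left_nonneg : ∀ t ∈ Icc (0:ℝ) 1, 0 ≤ A t
  left_pos : ∀ t ∈ Ico (0:ℝ) 1, 0 < A t
  right_le : ∀ t ∈ Icc (0:ℝ) 1, B t ≤ M
  right_nonneg : ∀ t ∈ Icc (0:ℝ) 1, 0 ≤ B t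
  right_pos : ∀ t ∈ Ioo (0:ℝ) 1, 0 < B t
  tail_le : ∀ s ∈ Icc (0:ℝ) 1, ∫ r in s..1, B r ≤ L ^ q * A s

/-- Continuous functions on `[0,1]` with values in `[0,C]`. -/
def BoundedProfile (C : ℝ) (w : ℝ → ℝ) : Prop :=
  ContinuousOn w (Icc 0 1) ∧ ∀ t ∈ Icc (0:ℝ) 1, 0 ≤ w t ∧ w t ≤ C

/-- The flux `∫_s^1 w^q B`. -/
def tailFlux (q : ℝ) (B w : ℝ → ℝ) (s : ℝ) : ℝ := ∫ r in s..1, w r ^ q * B r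

/-- The slope of the solution of the inverse problem with right-hand side `w`. -/
def invSlope (q : ℝ) (A B w : ℝ → ℝ) (s : ℝ) : ℝ := (tailFlux q B w s / A s) ^ q⁻¹

/-- The solution operator of `-(A (u')^q)' = B w^q`, `u(0) = 0`, with natural condition at `1`. -/
def invOp (q : ℝ) (A B w : ℝ → ℝ) (t : ℝ) : ℝ := ∫ s in (0:ℝ)..t, invSlope q A B w s

lemma IntervalIntegrable.sub_unit {f : ℝ → ℝ} (hf : IntervalIntegrable f volume 0 1) {a b : ℝ}
    (ha : a ∈ Icc (0:ℝ) 1) (hb : b ∈ Icc (0:ℝ) 1) : IntervalIntegrable f volume a b := by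
  refine hf.mono_set ?_
  rw [uIcc_of_le (zero_le_one' ℝ)]
  exact uIcc_subset_Icc ha hb

lemma uIoc_subset_unit {a b : ℝ} (ha : a ∈ Icc (0:ℝ) 1) (hb : b ∈ Icc (0:ℝ) 1) :
    uIoc a b ⊆ Icc (0:ℝ) 1 :=
  uIoc_subset_uIcc.trans (uIcc_subset_Icc ha hb)

lemma intervalIntegrable_unit_of_bounded {f : ℝ → ℝ} {C : ℝ}
    (hf : AEStronglyMeasurable f (volume.restrict (Icc 0 1)))
    (hb : ∀ᵐ t ∂volume, t ∈ Icc (0:ℝ) 1 → |f t| ≤ C) : IntervalIntegrable f volume 0 1 := by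
  rw [intervalIntegrable_iff_integrableOn_Icc_of_le zero_le_one]
  refine Integrable.of_bound hf C ?_
  rw [ae_restrict_iff' measurableSet_Icc]
  exact hb

lemma intervalIntegrable_unit_of_bounded' {f : ℝ → ℝ} {C : ℝ}
    (hf : AEStronglyMeasurable f (volume.restrict (Icc 0 1)))
    (hb : ∀ t ∈ Icc (0:ℝ) 1, |f t| ≤ C) : IntervalIntegrable f volume 0 1 :=
  intervalIntegrable_unit_of_bounded hf (Eventually.of_forall hb)

namespace WeightPair

variable {q L M C : ℝ} {A B v w : ℝ → ℝ}

lemma q_pos (H : WeightPair q A B L M) : 0 < q := zero_lt_one.trans_le H.one_le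

lemma integrable_right (H : WeightPair q A B L M) : IntervalIntegrable B volume 0 1 :=
  intervalIntegrable_unit_of_bounded' (C := M) H.measurable_right.aestronglyMeasurable fun t ht => by
    rw [abs_of_nonneg (H.right_nonneg t ht)]; exact H.right_le t ht

lemma integrable_flux (H : WeightPair q A B L M) (hw : ContinuousOn w (Icc 0 1)) :
    IntervalIntegrable (fun r => w r ^ q * B r) volume 0 1 := by
  refine H.integrable_right.continuousOn_mul ?_
  rw [uIcc_of_le zero_le_one]
  exact hw.rpow_const fun x _ => Or.inr H.q_pos.le

lemma tailFlux_mono (H : WeightPair q A B L M) (hv : BoundedProfile C v)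
    (hw : ContinuousOn w (Icc 0 1)) (hvw : ∀ t ∈ Icc (0:ℝ) 1, v t ≤ w t) {s : ℝ}
    (hs : s ∈ Icc (0:ℝ) 1) : tailFlux q B v s ≤ tailFlux q B w s := by
  have h1 : (1:ℝ) ∈ Icc (0:ℝ) 1 := by simp
  refine intervalIntegral.integral_mono_on hs.2 ((H.integrable_flux hv.1).sub_unit hs h1)
    ((H.integrable_flux hw).sub_unit hs h1) fun t ht => ?_
  have ht' : t ∈ Icc (0:ℝ) 1 := ⟨hs.1.trans ht.1, ht.2⟩
  exact mul_le_mul_of_nonneg_right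
    (Real.rpow_le_rpow (hv.2 t ht').1 (hvw t ht') H.q_pos.le) (H.right_nonneg t ht')

lemma tailFlux_nonneg (H : WeightPair q A B L M) (hv : BoundedProfile C v) {s : ℝ}
    (hs : s ∈ Icc (0:ℝ) 1) : 0 ≤ tailFlux q B v s :=
  intervalIntegral.integral_nonneg hs.2 fun t ht => by
    have ht' : t ∈ Icc (0:ℝ) 1 := ⟨hs.1.trans ht.1, ht.2⟩
    exact mul_nonneg (Real.rpow_nonneg (hv.2 t ht').1 _) (H.right_nonneg t ht')

lemma tailFlux_le (H : WeightPair q A B L M) (hv : BoundedProfile C v) {s : ℝ}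
    (hs : s ∈ Icc (0:ℝ) 1) : tailFlux q B v s ≤ (C * L) ^ q * A s := by
  have h1 : (1:ℝ) ∈ Icc (0:ℝ) 1 := by simp
  have hC : 0 ≤ C := (hv.2 1 h1).1.trans (hv.2 1 h1).2
  calc tailFlux q B v s ≤ tailFlux q B (fun _ => C) s :=
        H.tailFlux_mono hv continuousOn_const (fun t ht => (hv.2 t ht).2) hs
    _ = C ^ q * ∫ r in s..1, B r := by simp [tailFlux]
    _ ≤ C ^ q * (L ^ q * A s) :=
        mul_le_mul_of_nonneg_left (H.tail_le s hs) (Real.rpow_nonneg hC _)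
    _ = (C * L) ^ q * A s := by rw [Real.mul_rpow hC H.lip_pos.le]; ring

lemma continuousOn_tailFlux (H : WeightPair q A B L M) (hv : ContinuousOn v (Icc 0 1)) :
    ContinuousOn (tailFlux q B v) (Icc 0 1) := by
  have h := (H.integrable_flux hv).symm.absolutelyContinuousOnInterval_intervalIntegral
    (c := 1) (by simp)
  have h2 := h.continuousOn.neg
  rw [uIcc_of_ge zero_le_one] at h2
  refine h2.congr fun s _ => ?_
  simp only [tailFlux]
  rw [intervalIntegral.integral_symm]; rfl

lemma invSlope_nonneg (H : WeightPair q A B L M) (hv : BoundedProfile C v) {s : ℝ}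
    (hs : s ∈ Icc (0:ℝ) 1) : 0 ≤ invSlope q A B v s :=
  Real.rpow_nonneg (div_nonneg (H.tailFlux_nonneg hv hs) (H.left_nonneg s hs)) _

lemma invSlope_le (H : WeightPair q A B L M) (hv : BoundedProfile C v) {s : ℝ}
    (hs : s ∈ Icc (0:ℝ) 1) : invSlope q A B v s ≤ C * L := by
  have h1 : (1:ℝ) ∈ Icc (0:ℝ) 1 := by simp
  have hC : 0 ≤ C := (hv.2 1 h1).1.trans (hv.2 1 h1).2
  have hCL : 0 ≤ C * L := mul_nonneg hC H.lip_pos.le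
  have : tailFlux q B v s / A s ≤ (C * L) ^ q :=
    div_le_of_le_mul₀ (H.left_nonneg s hs) (Real.rpow_nonneg hCL _) (H.tailFlux_le hv hs)
  calc invSlope q A B v s ≤ ((C * L) ^ q) ^ q⁻¹ :=
        Real.rpow_le_rpow (div_nonneg (H.tailFlux_nonneg hv hs) (H.left_nonneg s hs)) this
          (inv_nonneg.2 H.q_pos.le)
    _ = C * L := Real.rpow_rpow_inv hCL H.q_pos.ne'

lemma aestronglyMeasurable_invSlope (H : WeightPair q A B L M) (hv : ContinuousOn v (Icc 0 1)) :
    AEStronglyMeasurable (invSlope q A B v) (volume.restrict (Icc 0 1)) := by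
  have h := ((H.continuousOn_tailFlux hv).aestronglyMeasurable
    (μ := volume) measurableSet_Icc).aemeasurable
  exact ((h.div H.measurable_left.aemeasurable).pow_const _).aestronglyMeasurable

lemma integrable_invSlope (H : WeightPair q A B L M) (hv : BoundedProfile C v) :
    IntervalIntegrable (invSlope q A B v) volume 0 1 :=
  intervalIntegrable_unit_of_bounded' (C := C * L) (H.aestronglyMeasurable_invSlope hv.1)
    fun t ht => by
      rw [abs_of_nonneg (H.invSlope_nonneg hv ht)]; exact H.invSlope_le hv ht

lemma invOp_sub (H : WeightPair q A B L M) (hv : BoundedProfile C v) {s t : ℝ}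
    (hs : s ∈ Icc (0:ℝ) 1) (ht : t ∈ Icc (0:ℝ) 1) :
    invOp q A B v t - invOp q A B v s = ∫ r in s..t, invSlope q A B v r :=
  intervalIntegral.integral_interval_sub_left
    ((H.integrable_invSlope hv).sub_unit (by simp) ht)
    ((H.integrable_invSlope hv).sub_unit (by simp) hs)

lemma invOp_monotoneOn (H : WeightPair q A B L M) (hv : BoundedProfile C v) :
    MonotoneOn (invOp q A B v) (Icc 0 1) := fun s hs t ht hst => by
  rw [← sub_nonneg, H.invOp_sub hv hs ht]
  exact intervalIntegral.integral_nonneg hst fun r hr =>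
    H.invSlope_nonneg hv ⟨hs.1.trans hr.1, hr.2.trans ht.2⟩

lemma invOp_dist_le (H : WeightPair q A B L M) (hv : BoundedProfile C v) {s t : ℝ}
    (hs : s ∈ Icc (0:ℝ) 1) (ht : t ∈ Icc (0:ℝ) 1) :
    dist (invOp q A B v s) (invOp q A B v t) ≤ C * L * dist s t := by
  rw [Real.dist_eq, Real.dist_eq, H.invOp_sub hv ht hs]
  refine intervalIntegral.norm_integral_le_of_norm_le_const (f := invSlope q A B v) fun r hr => ?_
  have hr' := uIoc_subset_unit ht hs hr
  rw [Real.norm_eq_abs, abs_of_nonneg (H.invSlope_nonneg hv hr')]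
  exact H.invSlope_le hv hr'

lemma invOp_lipschitzOnWith (H : WeightPair q A B L M) (hv : BoundedProfile C v) :
    LipschitzOnWith (Real.toNNReal (C * L)) (invOp q A B v) (Icc 0 1) := by
  have h1 : (1:ℝ) ∈ Icc (0:ℝ) 1 := by simp
  have hC : 0 ≤ C := (hv.2 1 h1).1.trans (hv.2 1 h1).2
  refine LipschitzOnWith.of_dist_le_mul fun s hs t ht => ?_
  rw [Real.coe_toNNReal _ (mul_nonneg hC H.lip_pos.le)]
  exact H.invOp_dist_le hv hs ht

lemma invOp_zero : invOp q A B v 0 = 0 := by simp [invOp]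

lemma invOp_nonneg (H : WeightPair q A B L M) (hv : BoundedProfile C v) {t : ℝ}
    (ht : t ∈ Icc (0:ℝ) 1) : 0 ≤ invOp q A B v t := by
  have := H.invOp_monotoneOn hv (by simp) ht ht.1
  rwa [invOp_zero] at this

lemma invOp_one_le (H : WeightPair q A B L M) (hv : BoundedProfile C v) :
    invOp q A B v 1 ≤ C * L := by
  have h := H.invOp_dist_le hv (s := 1) (t := 0) (by simp) (by simp)
  simp only [invOp_zero, Real.dist_eq, sub_zero, abs_one, mul_one] at h
  exact (le_abs_self _).trans h

lemma boundedProfile_invOp (H : WeightPair q A B L M) (hv : BoundedProfile C v) :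
    BoundedProfile (invOp q A B v 1) (invOp q A B v) :=
  ⟨(H.invOp_lipschitzOnWith hv).continuousOn, fun _ ht =>
    ⟨H.invOp_nonneg hv ht, H.invOp_monotoneOn hv ht (by simp) ht.2⟩⟩

lemma invSlope_mono (H : WeightPair q A B L M) (hv : BoundedProfile C v)
    (hw : ContinuousOn w (Icc 0 1)) (hvw : ∀ t ∈ Icc (0:ℝ) 1, v t ≤ w t) {s : ℝ}
    (hs : s ∈ Icc (0:ℝ) 1) : invSlope q A B v s ≤ invSlope q A B w s :=
  Real.rpow_le_rpow (div_nonneg (H.tailFlux_nonneg hv hs) (H.left_nonneg s hs))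
    (div_le_div_of_nonneg_right (H.tailFlux_mono hv hw hvw hs) (H.left_nonneg s hs))
    (inv_nonneg.2 H.q_pos.le)

lemma invOp_mono {C' : ℝ} (H : WeightPair q A B L M) (hv : BoundedProfile C v)
    (hw : BoundedProfile C' w) (hvw : ∀ t ∈ Icc (0:ℝ) 1, v t ≤ w t) {t : ℝ}
    (ht : t ∈ Icc (0:ℝ) 1) : invOp q A B v t ≤ invOp q A B w t :=
  intervalIntegral.integral_mono_on ht.1 ((H.integrable_invSlope hv).sub_unit (by simp) ht)
    ((H.integrable_invSlope hw).sub_unit (by simp) ht) fun r hr =>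
      H.invSlope_mono hv hw.1 hvw ⟨hr.1, hr.2.trans ht.2⟩

lemma tailFlux_const_mul (hv : BoundedProfile C v) {k s : ℝ} (hk : 0 ≤ k)
    (hs : s ∈ Icc (0:ℝ) 1) :
    tailFlux q B (fun t => k * v t) s = k ^ q * tailFlux q B v s := by
  rw [tailFlux, tailFlux, ← intervalIntegral.integral_const_mul]
  refine intervalIntegral.integral_congr fun r hr => ?_
  rw [uIcc_of_le hs.2] at hr
  simp only [Real.mul_rpow hk (hv.2 r ⟨hs.1.trans hr.1, hr.2⟩).1, mul_assoc]

lemma invOp_const_mul (H : WeightPair q A B L M) (hv : BoundedProfile C v) {k t : ℝ}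
    (hk : 0 ≤ k) (ht : t ∈ Icc (0:ℝ) 1) :
    invOp q A B (fun t => k * v t) t = k * invOp q A B v t := by
  rw [invOp, invOp, ← intervalIntegral.integral_const_mul]
  refine intervalIntegral.integral_congr fun r hr => ?_
  rw [uIcc_of_le ht.1] at hr
  have hr' : r ∈ Icc (0:ℝ) 1 := ⟨hr.1, hr.2.trans ht.2⟩
  simp only [invSlope, tailFlux_const_mul hv hk hr', mul_div_assoc]
  rw [Real.mul_rpow (Real.rpow_nonneg hk _)
    (div_nonneg (H.tailFlux_nonneg hv hr') (H.left_nonneg r hr')),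
    Real.rpow_rpow_inv hk H.q_pos.ne']

lemma _root_.BoundedProfile.const_mul (hv : BoundedProfile C v) {k : ℝ} (hk : 0 ≤ k) :
    BoundedProfile (k * C) (fun t => k * v t) :=
  ⟨continuousOn_const.mul hv.1, fun t ht => ⟨mul_nonneg hk (hv.2 t ht).1,
    mul_le_mul_of_nonneg_left (hv.2 t ht).2 hk⟩⟩

lemma tendsto_tailFlux (H : WeightPair q A B L M) {z : ℕ → ℝ → ℝ} (hz : ∀ k, BoundedProfile C (z k))
    (hlim : ∀ t ∈ Icc (0:ℝ) 1, Tendsto (fun k => z k t) atTop (𝓝 (v t))) {s : ℝ}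
    (hs : s ∈ Icc (0:ℝ) 1) :
    Tendsto (fun k => tailFlux q B (z k) s) atTop (𝓝 (tailFlux q B v s)) := by
  have h1 : (1:ℝ) ∈ Icc (0:ℝ) 1 := by simp
  refine intervalIntegral.tendsto_integral_filter_of_dominated_convergence
    (fun r => C ^ q * B r) ?_ ?_ ((H.integrable_right.const_mul _).sub_unit hs h1) ?_
  · refine Eventually.of_forall fun k => ?_
    exact ((H.integrable_flux (hz k).1).sub_unit hs h1).def'.aestronglyMeasurable
  · refine Eventually.of_forall fun k => Eventually.of_forall fun r hr => ?_
    have hr' := uIoc_subset_unit hs h1 hr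
    have hz' := (hz k).2 r hr'
    rw [Real.norm_eq_abs, abs_of_nonneg (mul_nonneg (Real.rpow_nonneg hz'.1 _)
      (H.right_nonneg r hr'))]
    exact mul_le_mul_of_nonneg_right (Real.rpow_le_rpow hz'.1 hz'.2 H.q_pos.le)
      (H.right_nonneg r hr')
  · refine Eventually.of_forall fun r hr => ?_
    have hr' := uIoc_subset_unit hs h1 hr
    exact ((hlim r hr').rpow_const (Or.inr H.q_pos.le)).mul_const _

lemma tendsto_invOp (H : WeightPair q A B L M) {z : ℕ → ℝ → ℝ} (hz : ∀ k, BoundedProfile C (z k))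
    (hlim : ∀ t ∈ Icc (0:ℝ) 1, Tendsto (fun k => z k t) atTop (𝓝 (v t))) {t : ℝ}
    (ht : t ∈ Icc (0:ℝ) 1) :
    Tendsto (fun k => invOp q A B (z k) t) atTop (𝓝 (invOp q A B v t)) := by
  have h0 : (0:ℝ) ∈ Icc (0:ℝ) 1 := by simp
  refine intervalIntegral.tendsto_integral_filter_of_dominated_convergence
    (fun r => C * L) ?_ ?_ intervalIntegrable_const ?_
  · refine Eventually.of_forall fun k => ?_
    exact ((H.integrable_invSlope (hz k)).sub_unit h0 ht).def'.aestronglyMeasurable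
  · refine Eventually.of_forall fun k => Eventually.of_forall fun r hr => ?_
    have hr' := uIoc_subset_unit h0 ht hr
    rw [Real.norm_eq_abs, abs_of_nonneg (H.invSlope_nonneg (hz k) hr')]
    exact H.invSlope_le (hz k) hr'
  · refine Eventually.of_forall fun r hr => ?_
    have hr' := uIoc_subset_unit h0 ht hr
    exact ((H.tendsto_tailFlux hz hlim hr').div_const _).rpow_const
      (Or.inr (inv_nonneg.2 H.q_pos.le))

end WeightPair

/-- A sequence of equi-Lipschitz profiles has a pointwise convergent subsequence with
continuous limit. -/
lemma exists_subseq_tendsto_of_lipschitz {K : NNReal} {f : ℕ → ℝ → ℝ} {C : ℝ}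
    (hf : ∀ k, LipschitzOnWith K (f k) (Icc 0 1)) (hb : ∀ k, BoundedProfile C (f k)) :
    ∃ (g : ℝ → ℝ) (θ : ℕ → ℕ), StrictMono θ ∧ BoundedProfile C g ∧
      ∀ t ∈ Icc (0:ℝ) 1, Tendsto (fun k => f (θ k) t) atTop (𝓝 (g t)) := by
  let F : ℕ → BoundedContinuousFunction (Icc (0:ℝ) 1) ℝ := fun k =>
    BoundedContinuousFunction.mkOfCompact ⟨(Icc (0:ℝ) 1).domRestrict (f k), (hb k).1.domRestrict⟩
  have hF : ∀ k x, F k x = f k x := fun k x => rfl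
  let S : Set (BoundedContinuousFunction (Icc (0:ℝ) 1) ℝ) := range F
  have hS : IsCompact (closure S) := by
    refine BoundedContinuousFunction.arzela_ascoli (Icc 0 C) isCompact_Icc S ?_ ?_
    · rintro _ x ⟨k, rfl⟩
      exact (hb k).2 x x.2
    · refine (LipschitzWith.uniformEquicontinuous _ K ?_).equicontinuous
      rintro ⟨_, k, rfl⟩
      exact (hf k).to_restrict
  obtain ⟨g, -, θ, hθ, hg⟩ := hS.tendsto_subseq (x := F) fun k => subset_closure ⟨k, rfl⟩
  have hlim : ∀ t (ht : t ∈ Icc (0:ℝ) 1), Tendsto (fun k => f (θ k) t) atTop (𝓝 (g ⟨t, ht⟩)) := by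
    intro t ht
    exact (BoundedContinuousFunction.tendsto_iff_tendstoUniformly.1 hg).tendsto_at ⟨t, ht⟩
  refine ⟨IccExtend zero_le_one g, θ, hθ, ⟨?_, ?_⟩, ?_⟩
  · exact g.continuous.Icc_extend'.continuousOn
  · intro t ht
    rw [IccExtend_of_mem _ _ ht]
    exact ⟨ge_of_tendsto' (hlim t ht) fun k => ((hb _).2 t ht).1,
      le_of_tendsto' (hlim t ht) fun k => ((hb _).2 t ht).2⟩
  · intro t ht
    rw [IccExtend_of_mem _ _ ht]
    exact hlim t ht

namespace WeightPair

variable {q L M C : ℝ} {A B v w z : ℝ → ℝ}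

lemma bound_pos (H : WeightPair q A B L M) : 0 < M :=
  (H.left_pos 0 (by simp)).trans_le (H.left_le 0 (by simp))

lemma exists_tailFlux_add_le {C' : ℝ} (H : WeightPair q A B L M) (hv : BoundedProfile C v)
    (hw : BoundedProfile C' w) (hvw : ∀ t ∈ Icc (0:ℝ) 1, v t ≤ w t) {t₁ : ℝ}
    (ht₁ : t₁ ∈ Icc (0:ℝ) 1) (hlt : v t₁ < w t₁) :
    ∃ a ∈ Ioo (0:ℝ) 1, ∃ d > 0, ∀ s ∈ Icc (0:ℝ) a,
      tailFlux q B v s + d ≤ tailFlux q B w s := by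
  have h1 : (1:ℝ) ∈ Icc (0:ℝ) 1 := by simp
  obtain ⟨t₂, ht₂, hlt₂⟩ : ∃ t₂ ∈ Ioo (0:ℝ) 1, v t₂ < w t₂ := by
    have hev : ∀ᶠ t in 𝓝[Icc 0 1] t₁, v t < w t :=
      (hv.1 t₁ ht₁).eventually_lt (hw.1 t₁ ht₁) hlt
    have hcl : t₁ ∈ closure (Ioo (0:ℝ) 1) := by rwa [closure_Ioo zero_ne_one]
    have := mem_closure_iff_nhdsWithin_neBot.1 hcl
    obtain ⟨t, h, h'⟩ := ((hev.filter_mono (nhdsWithin_mono _ Ioo_subset_Icc_self)).and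
      self_mem_nhdsWithin).exists
    exact ⟨t, h', h⟩
  have hnhds : Icc (0:ℝ) 1 ∈ 𝓝 t₂ := Icc_mem_nhds ht₂.1 ht₂.2
  have hev : ∀ᶠ t in 𝓝 t₂, v t < w t ∧ t ∈ Ioo (0:ℝ) 1 :=
    ((hv.1.continuousAt hnhds).eventually_lt (hw.1.continuousAt hnhds) hlt₂).and
      (Ioo_mem_nhds ht₂.1 ht₂.2)
  obtain ⟨l, u, hlu, hsub⟩ := mem_nhds_iff_exists_Ioo_subset.1 hev
  obtain ⟨a, hla, hat⟩ := exists_between hlu.1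
  have hav : ∀ t ∈ Icc a t₂, v t < w t ∧ t ∈ Ioo (0:ℝ) 1 := fun t ht =>
    hsub ⟨hla.trans_le ht.1, ht.2.trans_lt hlu.2⟩
  have ha := (hav a ⟨le_rfl, hat.le⟩).2
  have hint := (H.integrable_flux hw.1).sub (H.integrable_flux hv.1)
  refine ⟨a, ha, ∫ r in a..t₂, (w r ^ q * B r - v r ^ q * B r), ?_, ?_⟩
  · refine intervalIntegral.intervalIntegral_pos_of_pos_on
      (hint.sub_unit (Ioo_subset_Icc_self ha) (Ioo_subset_Icc_self ht₂)) (fun r hr => ?_) hat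
    obtain ⟨h2, h3⟩ := hav r (Ioo_subset_Icc_self hr)
    rw [sub_pos]
    exact mul_lt_mul_of_pos_right
      (Real.rpow_lt_rpow (hv.2 r (Ioo_subset_Icc_self h3)).1 h2 H.q_pos) (H.right_pos r h3)
  · intro s hs
    have hs' : s ∈ Icc (0:ℝ) 1 := ⟨hs.1, hs.2.trans ha.2.le⟩
    have hsub : tailFlux q B w s - tailFlux q B v s =
        ∫ r in s..1, (w r ^ q * B r - v r ^ q * B r) :=
      (intervalIntegral.integral_sub ((H.integrable_flux hw.1).sub_unit hs' h1)
        ((H.integrable_flux hv.1).sub_unit hs' h1)).symm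
    have hmono : ∫ r in a..t₂, (w r ^ q * B r - v r ^ q * B r) ≤
        ∫ r in s..1, (w r ^ q * B r - v r ^ q * B r) := by
      refine intervalIntegral.integral_mono_interval hs.2 hat.le ht₂.2.le ?_
        (hint.sub_unit hs' h1)
      refine (ae_restrict_iff' measurableSet_Ioc).2 (Eventually.of_forall fun r hr => ?_)
      have hr' : r ∈ Icc (0:ℝ) 1 := ⟨hs'.1.trans hr.1.le, hr.2⟩
      simp only [Pi.zero_apply, sub_nonneg]
      exact mul_le_mul_of_nonneg_right
        (Real.rpow_le_rpow (hv.2 r hr').1 (hvw r hr') H.q_pos.le) (H.right_nonneg r hr')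
    linarith

lemma exists_le_tailFlux (H : WeightPair q A B L M) (hw : BoundedProfile C w) {t₁ : ℝ}
    (ht₁ : t₁ ∈ Icc (0:ℝ) 1) (hlt : 0 < w t₁) :
    ∃ a ∈ Ioo (0:ℝ) 1, ∃ d > 0, ∀ s ∈ Icc (0:ℝ) a, d ≤ tailFlux q B w s := by
  obtain ⟨a, ha, d, hd, h⟩ := H.exists_tailFlux_add_le (C := 0) (v := fun _ => 0)
    ⟨continuousOn_const, by simp⟩ hw (fun t ht => (hw.2 t ht).1) ht₁ hlt
  refine ⟨a, ha, d, hd, fun s hs => ?_⟩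
  have := h s hs
  simpa [tailFlux, Real.zero_rpow H.q_pos.ne'] using this

/-- The solution operator has a linear lower bound on nontrivial profiles. -/
lemma exists_mul_le_invOp (H : WeightPair q A B L M) (hw : BoundedProfile C w) {t₁ : ℝ}
    (ht₁ : t₁ ∈ Icc (0:ℝ) 1) (hlt : 0 < w t₁) :
    ∃ k > 0, ∀ t ∈ Icc (0:ℝ) 1, k * t ≤ invOp q A B w t := by
  obtain ⟨a, ha, d, hd, h⟩ := H.exists_le_tailFlux hw ht₁ hlt
  have hM := H.bound_pos
  set κ := (d / M) ^ q⁻¹ with hκ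
  have hκ0 : 0 < κ := Real.rpow_pos_of_pos (div_pos hd hM) _
  have hlow : ∀ t ∈ Icc (0:ℝ) a, κ * t ≤ invOp q A B w t := by
    intro t ht
    have ht' : t ∈ Icc (0:ℝ) 1 := ⟨ht.1, ht.2.trans ha.2.le⟩
    have hc : ∫ _ in (0:ℝ)..t, κ = κ * t := by simp [mul_comm]
    rw [← hc]
    refine intervalIntegral.integral_mono_on ht.1 intervalIntegrable_const
      ((H.integrable_invSlope hw).sub_unit (by simp) ht') fun s hs => ?_
    have hs' : s ∈ Ico (0:ℝ) 1 := ⟨hs.1, (hs.2.trans ht.2).trans_lt ha.2⟩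
    refine Real.rpow_le_rpow (div_pos hd hM).le ?_ (inv_nonneg.2 H.q_pos.le)
    exact div_le_div₀ (hd.le.trans (h s ⟨hs.1, hs.2.trans ht.2⟩)) (h s ⟨hs.1, hs.2.trans ht.2⟩)
      (H.left_pos s hs') (H.left_le s (Ico_subset_Icc_self hs'))
  refine ⟨κ * a, mul_pos hκ0 ha.1, fun t ht => ?_⟩
  rcases le_total t a with hta | hta
  · refine le_trans ?_ (hlow t ⟨ht.1, hta⟩)
    have : κ * a ≤ κ := mul_le_of_le_one_right hκ0.le ha.2.le
    exact mul_le_mul_of_nonneg_right this ht.1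
  · calc κ * a * t ≤ κ * a := mul_le_of_le_one_right (mul_pos hκ0 ha.1).le ht.2
      _ ≤ invOp q A B w a := hlow a ⟨ha.1.le, le_rfl⟩
      _ ≤ invOp q A B w t := H.invOp_monotoneOn hw (Ioo_subset_Icc_self ha) ht hta

lemma invOp_pos (H : WeightPair q A B L M) (hw : BoundedProfile C w) {t₁ : ℝ}
    (ht₁ : t₁ ∈ Icc (0:ℝ) 1) (hlt : 0 < w t₁) {t : ℝ} (ht : t ∈ Ioc (0:ℝ) 1) :
    0 < invOp q A B w t := by
  obtain ⟨k, hk, h⟩ := H.exists_mul_le_invOp hw ht₁ hlt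
  exact (mul_pos hk ht.1).trans_le (h t (Ioc_subset_Icc_self ht))

/-- Numbers `ρ` admitting a normalized profile `w` with `ρ w ≤ T w`, where `T` is the solution
operator. -/
def subEigenvalues (q : ℝ) (A B : ℝ → ℝ) : Set ℝ :=
  {ρ | ∃ w, BoundedProfile 1 w ∧ w 1 = 1 ∧ ∀ t ∈ Icc (0:ℝ) 1, ρ * w t ≤ invOp q A B w t}

lemma exists_pos_mem_subEigenvalues (H : WeightPair q A B L M) :
    ∃ ρ > 0, ρ ∈ subEigenvalues q A B := by
  have hid : BoundedProfile 1 (fun t : ℝ => t) := ⟨continuousOn_id, fun t ht => ht⟩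
  obtain ⟨k, hk, h⟩ := H.exists_mul_le_invOp hid (t₁ := 1) (by simp) one_pos
  exact ⟨k, hk, _, hid, rfl, h⟩

lemma subEigenvalues_le (H : WeightPair q A B L M) {ρ : ℝ} (hρ : ρ ∈ subEigenvalues q A B) :
    ρ ≤ L := by
  obtain ⟨w, hw, hw1, h⟩ := hρ
  have h2 := (h 1 (by simp)).trans (H.invOp_one_le hw)
  rwa [hw1, mul_one, one_mul] at h2

lemma bddAbove_subEigenvalues (H : WeightPair q A B L M) : BddAbove (subEigenvalues q A B) :=
  ⟨L, fun _ h => H.subEigenvalues_le h⟩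

/-- Normalization of `T w`. -/
lemma normalize_invOp (H : WeightPair q A B L M) (hw : BoundedProfile C w)
    (hpos : 0 < invOp q A B w 1) :
    BoundedProfile 1 (fun t => (invOp q A B w 1)⁻¹ * invOp q A B w t) := by
  have := (H.boundedProfile_invOp hw).const_mul (inv_nonneg.2 hpos.le)
  rwa [inv_mul_cancel₀ hpos.ne'] at this

lemma mul_normalize_invOp_le {ρ : ℝ} (H : WeightPair q A B L M) (hw : BoundedProfile C w)
    (hpos : 0 < invOp q A B w 1)
    (h : ∀ t ∈ Icc (0:ℝ) 1, ρ * invOp q A B w t ≤ invOp q A B (invOp q A B w) t) :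
    ∀ t ∈ Icc (0:ℝ) 1, ρ * ((invOp q A B w 1)⁻¹ * invOp q A B w t) ≤
      invOp q A B (fun t => (invOp q A B w 1)⁻¹ * invOp q A B w t) t := by
  intro t ht
  rw [H.invOp_const_mul (H.boundedProfile_invOp hw) (inv_nonneg.2 hpos.le) ht, mul_left_comm]
  exact mul_le_mul_of_nonneg_left (h t ht) (inv_nonneg.2 hpos.le)

/-- A strict subsolution can be improved. -/
lemma exists_lt_subEigenvalues {r : ℝ} (H : WeightPair q A B L M) (hz : BoundedProfile 1 z)
    (hz1 : z 1 = 1) (hr : 0 < r) (hle : ∀ t ∈ Icc (0:ℝ) 1, r * z t ≤ invOp q A B z t) {t₁ : ℝ}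
    (ht₁ : t₁ ∈ Icc (0:ℝ) 1) (hlt : r * z t₁ < invOp q A B z t₁) :
    ∃ r' > r, r' ∈ subEigenvalues q A B := by
  have h1 : (1:ℝ) ∈ Icc (0:ℝ) 1 := by simp
  have h0 : (0:ℝ) ∈ Icc (0:ℝ) 1 := by simp
  set u := invOp q A B z with hu
  set v : ℝ → ℝ := fun t => r * z t with hv
  have hzpos : 0 < z 1 := by rw [hz1]; exact one_pos
  have hu1 : 0 < u 1 := H.invOp_pos hz h1 hzpos (by simp)
  have hub : BoundedProfile (u 1) u := H.boundedProfile_invOp hz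
  have hvb : BoundedProfile r v := by simpa using hz.const_mul hr.le
  have hv1 : 0 < v 1 := mul_pos hr hzpos
  have hTv : ∀ t ∈ Icc (0:ℝ) 1, invOp q A B v t = r * u t := fun t ht =>
    H.invOp_const_mul hz hr.le ht
  obtain ⟨a, ha, d, hd, hflux⟩ := H.exists_tailFlux_add_le hvb hub hle ht₁ hlt
  have ha' : a ∈ Icc (0:ℝ) 1 := Ioo_subset_Icc_self ha
  set g := (r * L) ^ q * M with hg
  have hgpos : 0 < g := mul_pos (Real.rpow_pos_of_pos (mul_pos hr H.lip_pos) _) H.bound_pos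
  set η := (1 + d / g) ^ q⁻¹ - 1 with hη
  have hdg : 0 < d / g := div_pos hd hgpos
  have hηpos : 0 < η := by
    rw [hη, sub_pos]
    exact Real.one_lt_rpow (by linarith) (inv_pos.2 H.q_pos)
  have hslope : ∀ s ∈ Icc (0:ℝ) a, (1 + η) * invSlope q A B v s ≤ invSlope q A B u s := by
    intro s hs
    have hs' : s ∈ Icc (0:ℝ) 1 := ⟨hs.1, hs.2.trans ha.2.le⟩
    have hv0 := H.tailFlux_nonneg hvb hs'
    have hvg : tailFlux q B v s ≤ g := (H.tailFlux_le hvb hs').trans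
      (mul_le_mul_of_nonneg_left (H.left_le s hs')
        (Real.rpow_nonneg (mul_pos hr H.lip_pos).le _))
    have hkey : (1 + d / g) * tailFlux q B v s ≤ tailFlux q B u s := by
      have : d / g * tailFlux q B v s ≤ d := by
        rw [div_mul_eq_mul_div, div_le_iff₀ hgpos]
        exact mul_le_mul_of_nonneg_left hvg hd.le
      linarith [hflux s hs]
    have hA := H.left_nonneg s hs'
    rw [hη, add_sub_cancel, invSlope, ← Real.mul_rpow (by positivity) (div_nonneg hv0 hA),
      ← mul_div_assoc]
    exact Real.rpow_le_rpow (by positivity) (div_le_div_of_nonneg_right hkey hA)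
      (inv_nonneg.2 H.q_pos.le)
  have hlow : ∀ t ∈ Icc (0:ℝ) a, (1 + η) * invOp q A B v t ≤ invOp q A B u t := by
    intro t ht
    have ht' : t ∈ Icc (0:ℝ) 1 := ⟨ht.1, ht.2.trans ha.2.le⟩
    rw [invOp, invOp, ← intervalIntegral.integral_const_mul]
    exact intervalIntegral.integral_mono_on ht.1
      (((H.integrable_invSlope hvb).const_mul _).sub_unit h0 ht')
      ((H.integrable_invSlope hub).sub_unit h0 ht') fun s hs => hslope s ⟨hs.1, hs.2.trans ht.2⟩
  set κ := invOp q A B v a / invOp q A B v 1 with hκ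
  have hva : 0 < invOp q A B v a := H.invOp_pos hvb h1 hv1 ⟨ha.1, ha.2.le⟩
  have hvo : 0 < invOp q A B v 1 := H.invOp_pos hvb h1 hv1 (by simp)
  have hκpos : 0 < κ := div_pos hva hvo
  have hκle : κ ≤ 1 := (div_le_one hvo).2 (H.invOp_monotoneOn hvb ha' h1 ha.2.le)
  have hall : ∀ t ∈ Icc (0:ℝ) 1, (1 + η * κ) * invOp q A B v t ≤ invOp q A B u t := by
    intro t ht
    have htn := H.invOp_nonneg hvb ht
    rcases le_total t a with hta | hta
    · refine le_trans ?_ (hlow t ⟨ht.1, hta⟩)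
      have : η * κ ≤ η := mul_le_of_le_one_right hηpos.le hκle
      exact mul_le_mul_of_nonneg_right (by linarith) htn
    · have h2 : invOp q A B v t - invOp q A B v a ≤ invOp q A B u t - invOp q A B u a := by
        rw [H.invOp_sub hvb ha' ht, H.invOp_sub hub ha' ht]
        exact intervalIntegral.integral_mono_on hta ((H.integrable_invSlope hvb).sub_unit ha' ht)
          ((H.integrable_invSlope hub).sub_unit ha' ht) fun s hs =>
            H.invSlope_mono hvb hub.1 hle ⟨ha.1.le.trans hs.1, hs.2.trans ht.2⟩
      have h3 := hlow a ⟨ha.1.le, le_rfl⟩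
      have h4 : κ * invOp q A B v t ≤ invOp q A B v a := by
        rw [hκ, div_mul_eq_mul_div, div_le_iff₀ hvo]
        exact mul_le_mul_of_nonneg_left (H.invOp_monotoneOn hvb ht h1 ht.2) hva.le
      nlinarith [mul_le_mul_of_nonneg_left h4 hηpos.le]
  refine ⟨(1 + η * κ) * r, ?_, _, H.normalize_invOp hz hu1, inv_mul_cancel₀ hu1.ne',
    H.mul_normalize_invOp_le hz hu1 fun t ht => ?_⟩
  · have := mul_pos (mul_pos hηpos hκpos) hr
    nlinarith
  · have := hall t ht
    rwa [hTv t ht, ← mul_assoc] at this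

/-- Existence of a positive eigenfunction of the solution operator. -/
theorem exists_eigenfunction (H : WeightPair q A B L M) :
    ∃ r > 0, ∃ z, BoundedProfile 1 z ∧ z 1 = 1 ∧
      ∀ t ∈ Icc (0:ℝ) 1, invOp q A B z t = r * z t := by
  have h1 : (1:ℝ) ∈ Icc (0:ℝ) 1 := by simp
  set S := subEigenvalues q A B with hS
  obtain ⟨ρ₀, hρ₀, hρ₀S⟩ := H.exists_pos_mem_subEigenvalues
  have hbdd := H.bddAbove_subEigenvalues
  set r := sSup S with hr
  have hrpos : 0 < r := hρ₀.trans_le (le_csSup hbdd hρ₀S)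
  obtain ⟨ρ, -, hρlim, hρS⟩ := exists_seq_tendsto_sSup ⟨ρ₀, hρ₀S⟩ hbdd
  obtain ⟨N, hN⟩ := eventually_atTop.1 (hρlim.eventually (lt_mem_nhds (half_lt_self hrpos)))
  have hρS' : ∀ k, ∃ w, BoundedProfile 1 w ∧ w 1 = 1 ∧
    ∀ t ∈ Icc (0:ℝ) 1, ρ (k + N) * w t ≤ invOp q A B w t := fun k => hρS (k + N)
  choose w hw hw1 hle using hρS'
  have hhalf : ∀ k, r / 2 < ρ (k + N) := fun k => hN _ (Nat.le_add_left _ _)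
  have hw1' : ∀ k, r / 2 ≤ invOp q A B (w k) 1 := fun k => by
    have := hle k 1 h1
    rw [hw1, mul_one] at this
    exact (hhalf k).le.trans this
  have hpos : ∀ k, 0 < invOp q A B (w k) 1 := fun k => (half_pos hrpos).trans_le (hw1' k)
  let z : ℕ → ℝ → ℝ := fun k t => (invOp q A B (w k) 1)⁻¹ * invOp q A B (w k) t
  have hz : ∀ k, BoundedProfile 1 (z k) := fun k => H.normalize_invOp (hw k) (hpos k)
  have hzlip : ∀ k, LipschitzOnWith (Real.toNNReal ((r / 2)⁻¹ * L)) (z k) (Icc 0 1) := by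
    intro k
    have hr2 : 0 < (r / 2)⁻¹ := inv_pos.2 (half_pos hrpos)
    refine LipschitzOnWith.of_dist_le_mul fun s hs t ht => ?_
    rw [Real.coe_toNNReal _ (mul_pos hr2 H.lip_pos).le]
    have hd := H.invOp_dist_le (hw k) hs ht
    have hzd : dist (z k s) (z k t) =
        (invOp q A B (w k) 1)⁻¹ * dist (invOp q A B (w k) s) (invOp q A B (w k) t) := by
      simp only [z, Real.dist_eq]
      rw [← mul_sub, abs_mul, abs_of_pos (inv_pos.2 (hpos k))]
    rw [hzd, mul_assoc]
    rw [one_mul] at hd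
    exact mul_le_mul (inv_anti₀ (half_pos hrpos) (hw1' k)) hd dist_nonneg hr2.le
  have hzle : ∀ k, ∀ t ∈ Icc (0:ℝ) 1, ρ (k + N) * z k t ≤ invOp q A B (z k) t := by
    intro k
    refine H.mul_normalize_invOp_le (hw k) (hpos k) fun t ht => ?_
    have hρ0 : 0 ≤ ρ (k + N) := ((half_pos hrpos).trans (hhalf k)).le
    rw [← H.invOp_const_mul (hw k) hρ0 ht]
    exact H.invOp_mono ((hw k).const_mul hρ0) (H.boundedProfile_invOp (hw k)) (hle k) ht
  obtain ⟨g, θ, hθ, hg, hlim⟩ := exists_subseq_tendsto_of_lipschitz hzlip hz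
  have hg1 : g 1 = 1 := by
    have h2 : ∀ k, z (θ k) 1 = 1 := fun k => inv_mul_cancel₀ (hpos _).ne'
    have h3 := hlim 1 h1
    simp only [h2] at h3
    exact tendsto_nhds_unique h3 tendsto_const_nhds
  have hρθ : Tendsto (fun k => ρ (θ k + N)) atTop (𝓝 r) :=
    (hρlim.comp (tendsto_add_atTop_nat N)).comp hθ.tendsto_atTop
  have hgle : ∀ t ∈ Icc (0:ℝ) 1, r * g t ≤ invOp q A B g t := fun t ht =>
    le_of_tendsto_of_tendsto' (hρθ.mul (hlim t ht))
      (H.tendsto_invOp (fun k => hz (θ k)) hlim ht) fun k => hzle (θ k) t ht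
  refine ⟨r, hrpos, g, hg, hg1, fun t ht => ?_⟩
  by_contra hne
  obtain ⟨r', hr', hr'S⟩ := H.exists_lt_subEigenvalues hg hg1 hrpos hgle ht
    (lt_of_le_of_ne (hgle t ht) (Ne.symm hne))
  exact absurd (le_csSup hbdd hr'S) (not_le.2 hr')

end WeightPair

/-- The pointwise inequality behind Picone's identity. -/
lemma picone_pointwise {q a b x y : ℝ} (hq : 0 < q) (ha : 0 ≤ a) (hb : 0 ≤ b) (hx : 0 ≤ x)
    (hy : 0 < y) :
    b ^ q * ((q + 1) * (x ^ q * a) * y ^ (-q) - x ^ (q + 1) * (q * (y ^ (-q - 1) * b))) ≤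
      a ^ (q + 1) := by
  set ξ := x * b / y with hξ
  have hξ0 : 0 ≤ ξ := by positivity
  have h1 : ξ ^ q = b ^ q * x ^ q * y ^ (-q) := by
    rw [hξ, Real.div_rpow (by positivity) hy.le, Real.mul_rpow hx hb, Real.rpow_neg hy.le]
    field_simp
  have h2 : ξ ^ (q + 1) = b ^ q * x ^ (q + 1) * (y ^ (-q - 1) * b) := by
    rw [Real.rpow_add_one' hξ0 (by linarith), Real.rpow_add_one' hx (by linarith), h1,
      Real.rpow_sub_one hy.ne', hξ]
    field_simp
  have hconj : (q + 1).HolderConjugate ((q + 1) / q) := by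
    rw [Real.holderConjugate_iff]
    exact ⟨by linarith, by field_simp; ring⟩
  have hY := Real.young_inequality_of_nonneg ha (Real.rpow_nonneg hξ0 q) hconj
  rw [← Real.rpow_mul hξ0, mul_div_cancel₀ _ hq.ne'] at hY
  have hY' : (q + 1) * (a * ξ ^ q) ≤ a ^ (q + 1) + q * ξ ^ (q + 1) := by
    calc (q + 1) * (a * ξ ^ q) ≤
        (q + 1) * (a ^ (q + 1) / (q + 1) + ξ ^ (q + 1) / ((q + 1) / q)) :=
          mul_le_mul_of_nonneg_left hY (by linarith)
      _ = a ^ (q + 1) + q * ξ ^ (q + 1) := by field_simp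
  calc _ = (q + 1) * (a * (b ^ q * x ^ q * y ^ (-q))) -
        q * (b ^ q * x ^ (q + 1) * (y ^ (-q - 1) * b)) := by ring
    _ ≤ a ^ (q + 1) := by rw [← h1, ← h2]; linarith

/-- Postcomposition of a Lipschitz function on the unit interval with a `C¹` function. -/
lemma LipschitzOnWith.exists_comp_contDiffOn {f g : ℝ → ℝ} {K : NNReal} {a b : ℝ}
    (hf : LipschitzOnWith K f (Icc 0 1)) (hm : MapsTo f (Icc 0 1) (Icc a b))
    (hg : ContDiffOn ℝ 1 g (Icc a b)) :
    ∃ K', LipschitzOnWith K' (fun t => g (f t)) (Icc 0 1) := by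
  obtain ⟨K', hK'⟩ := hg.exists_lipschitzOnWith one_ne_zero (convex_Icc a b) isCompact_Icc
  exact ⟨_, hK'.comp hf hm⟩

lemma LipschitzOnWith.absolutelyContinuous_unit {f : ℝ → ℝ} {K : NNReal}
    (hf : LipschitzOnWith K f (Icc 0 1)) : AbsolutelyContinuousOnInterval f 0 1 :=
  LipschitzOnWith.absolutelyContinuousOnInterval (K := K) (by rwa [uIcc_of_le zero_le_one])

namespace WeightPair

variable {q L M C r : ℝ} {A B w z : ℝ → ℝ}

lemma integrable_num (H : WeightPair q A B L M) {K : NNReal}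
    (hw : LipschitzOnWith K w (Icc 0 1)) :
    IntervalIntegrable (fun t => |deriv w t| ^ (q + 1) * A t) volume 0 1 := by
  refine intervalIntegrable_unit_of_bounded (C := (K:ℝ) ^ (q + 1) * M) ?_ ?_
  · exact (((measurable_deriv w).abs.pow_const _).mul H.measurable_left).aestronglyMeasurable
  · filter_upwards [Ioo_ae_eq_Icc (μ := (volume : Measure ℝ)) (a := (0:ℝ)) (b := 1)] with t ht htm
    have ht' : t ∈ Ioo (0:ℝ) 1 := by
      have : (Ioo (0:ℝ) 1 t) = (Icc (0:ℝ) 1 t) := ht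
      exact this.mpr htm
    have hd : |deriv w t| ≤ K := norm_deriv_le_of_lipschitzOn (Icc_mem_nhds ht'.1 ht'.2) hw
    rw [abs_of_nonneg (mul_nonneg (Real.rpow_nonneg (abs_nonneg _) _) (H.left_nonneg t htm))]
    have hq := H.q_pos
    exact mul_le_mul (Real.rpow_le_rpow (abs_nonneg _) hd (by linarith)) (H.left_le t htm)
      (H.left_nonneg t htm) (Real.rpow_nonneg K.2 _)

lemma integrable_den (H : WeightPair q A B L M) (hw : ContinuousOn w (Icc 0 1)) :
    IntervalIntegrable (fun t => |w t| ^ (q + 1) * B t) volume 0 1 := by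
  refine H.integrable_right.continuousOn_mul ?_
  rw [uIcc_of_le zero_le_one]
  have hq := H.q_pos
  exact hw.abs.rpow_const fun x _ => Or.inr (by linarith)

lemma ae_hasDerivAt_tailFlux (H : WeightPair q A B L M) (hz : ContinuousOn z (Icc 0 1)) :
    ∀ᵐ t ∂volume, t ∈ Icc (0:ℝ) 1 → HasDerivAt (tailFlux q B z) (-(z t ^ q * B t)) t := by
  filter_upwards [(H.integrable_flux hz).ae_hasDerivAt_integral] with t ht htm
  rw [uIcc_of_le zero_le_one] at ht
  refine (ht htm 1 (by simp)).neg.congr_of_eventuallyEq (Eventually.of_forall fun s => ?_)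
  simp only [tailFlux]
  rw [intervalIntegral.integral_symm]; rfl

lemma tailFlux_absolutelyContinuous (H : WeightPair q A B L M) (hz : ContinuousOn z (Icc 0 1)) :
    AbsolutelyContinuousOnInterval (tailFlux q B z) 0 1 := by
  have h := ((H.integrable_flux hz).absolutelyContinuousOnInterval_intervalIntegral
    (c := 1) (by simp)).neg
  have he : tailFlux q B z = -(fun x => ∫ v in (1:ℝ)..x, z v ^ q * B v) := by
    funext s
    simp only [tailFlux]
    rw [intervalIntegral.integral_symm]; rfl
  rw [he]; exact h

/-- Integration by parts against the flux. -/
lemma integral_deriv_mul_tailFlux (H : WeightPair q A B L M) (hz : ContinuousOn z (Icc 0 1))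
    {h : ℝ → ℝ} (hh : AbsolutelyContinuousOnInterval h 0 1) (h0 : h 0 = 0) :
    ∫ t in (0:ℝ)..1, deriv h t * tailFlux q B z t = ∫ t in (0:ℝ)..1, h t * (z t ^ q * B t) := by
  have hparts := hh.integral_mul_deriv_eq_deriv_mul (H.tailFlux_absolutelyContinuous hz)
  have hG1 : tailFlux q B z 1 = 0 := by simp [tailFlux]
  rw [h0, hG1] at hparts
  have : ∫ t in (0:ℝ)..1, h t * deriv (tailFlux q B z) t =
      ∫ t in (0:ℝ)..1, -(h t * (z t ^ q * B t)) := by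
    refine intervalIntegral.integral_congr_ae ?_
    filter_upwards [H.ae_hasDerivAt_tailFlux hz] with t ht htm
    rw [uIoc_of_le zero_le_one] at htm
    rw [(ht (Ioc_subset_Icc_self htm)).deriv]; ring
  rw [this, intervalIntegral.integral_neg] at hparts
  linarith

lemma ae_hasDerivAt_eigenfunction (H : WeightPair q A B L M) (hz : BoundedProfile C z)
    (hr : 0 < r) (heig : ∀ t ∈ Icc (0:ℝ) 1, invOp q A B z t = r * z t) :
    ∀ᵐ t ∂volume, t ∈ Icc (0:ℝ) 1 → t ∈ Ioo (0:ℝ) 1 ∧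
      HasDerivAt z (r⁻¹ * invSlope q A B z t) t := by
  filter_upwards [(H.integrable_invSlope hz).ae_hasDerivAt_integral,
    Ioo_ae_eq_Icc (μ := (volume : Measure ℝ)) (a := (0:ℝ)) (b := 1)] with t ht hoo htm
  have ht' : t ∈ Ioo (0:ℝ) 1 := by
    have : (Ioo (0:ℝ) 1 t) = (Icc (0:ℝ) 1 t) := hoo
    exact this.mpr htm
  rw [uIcc_of_le zero_le_one] at ht
  refine ⟨ht', ((ht htm 0 (by simp)).const_mul r⁻¹).congr_of_eventuallyEq ?_⟩
  filter_upwards [Icc_mem_nhds ht'.1 ht'.2] with s hs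
  have := heig s hs
  rw [invOp] at this
  rw [this, inv_mul_cancel_left₀ hr.ne']

lemma left_mul_slope_rpow (H : WeightPair q A B L M) (hz : BoundedProfile C z)
    (hr : 0 < r) {t : ℝ} (ht : t ∈ Ioo (0:ℝ) 1) :
    A t * (r⁻¹ * invSlope q A B z t) ^ q = (r⁻¹) ^ q * tailFlux q B z t := by
  have ht' := Ioo_subset_Icc_self ht
  have hA := H.left_pos t ⟨ht.1.le, ht.2⟩
  rw [Real.mul_rpow (inv_pos.2 hr).le (H.invSlope_nonneg hz ht'), invSlope,
    Real.rpow_inv_rpow (div_nonneg (H.tailFlux_nonneg hz ht') hA.le) H.q_pos.ne']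
  field_simp

lemma eigenfunction_energy (H : WeightPair q A B L M) (hz : BoundedProfile C z) {K : NNReal}
    (hlip : LipschitzOnWith K z (Icc 0 1)) (hz0 : z 0 = 0)
    (hr : 0 < r) (heig : ∀ t ∈ Icc (0:ℝ) 1, invOp q A B z t = r * z t) :
    ∫ t in (0:ℝ)..1, |deriv z t| ^ (q + 1) * A t =
      (r⁻¹) ^ q * ∫ t in (0:ℝ)..1, |z t| ^ (q + 1) * B t := by
  have hq := H.q_pos
  have h1 : ∫ t in (0:ℝ)..1, |z t| ^ (q + 1) * B t =
      ∫ t in (0:ℝ)..1, z t * (z t ^ q * B t) := by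
    refine intervalIntegral.integral_congr fun t ht => ?_
    rw [uIcc_of_le zero_le_one] at ht
    simp only [abs_of_nonneg (hz.2 t ht).1]
    rw [Real.rpow_add_one' (hz.2 t ht).1 (by linarith)]; ring
  rw [h1, ← H.integral_deriv_mul_tailFlux hz.1 hlip.absolutelyContinuous_unit hz0,
    ← intervalIntegral.integral_const_mul]
  refine intervalIntegral.integral_congr_ae ?_
  filter_upwards [H.ae_hasDerivAt_eigenfunction hz hr heig] with t ht htm
  rw [uIoc_of_le zero_le_one] at htm
  obtain ⟨hoo, hd⟩ := ht (Ioc_subset_Icc_self htm)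
  have hb : 0 ≤ r⁻¹ * invSlope q A B z t :=
    mul_nonneg (inv_pos.2 hr).le (H.invSlope_nonneg hz (Ioo_subset_Icc_self hoo))
  rw [hd.deriv, abs_of_nonneg hb, Real.rpow_add_one' hb (by linarith)]
  have := H.left_mul_slope_rpow hz hr hoo
  linear_combination (r⁻¹ * invSlope q A B z t) * this

lemma picone_regularized (H : WeightPair q A B L M) (hz : BoundedProfile C z) {K K' : NNReal}
    (hlip : LipschitzOnWith K z (Icc 0 1))
    (hr : 0 < r) (heig : ∀ t ∈ Icc (0:ℝ) 1, invOp q A B z t = r * z t)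
    (hw : LipschitzOnWith K' w (Icc 0 1)) (hw0 : w 0 = 0) {δ : ℝ} (hδ : 0 < δ) :
    (r⁻¹) ^ q * ∫ t in (0:ℝ)..1, |w t| ^ (q + 1) * (z t + δ) ^ (-q) * (z t ^ q * B t) ≤
      ∫ t in (0:ℝ)..1, |deriv w t| ^ (q + 1) * A t := by
  have hq := H.q_pos
  have hq1 : 1 < q + 1 := by linarith
  obtain ⟨b, hb⟩ := isCompact_Icc.exists_bound_of_continuousOn hw.continuousOn
  obtain ⟨K₁, hK₁⟩ := hw.exists_comp_contDiffOn (a := -b) (b := b) (g := fun x => |x| ^ (q + 1))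
    (fun t ht => abs_le.1 (hb t ht)) (contDiff_norm_rpow (E := ℝ) hq1).contDiffOn
  obtain ⟨K₂, hK₂⟩ := hlip.exists_comp_contDiffOn (a := 0) (b := C)
    (g := fun x => (x + δ) ^ (-q)) (fun t ht => hz.2 t ht) (fun x hx =>
      ((contDiffAt_id.add contDiffAt_const).rpow_const_of_ne
        (by simpa using (add_pos_of_nonneg_of_pos hx.1 hδ).ne')).contDiffWithinAt)
  set h : ℝ → ℝ := fun t => |w t| ^ (q + 1) * (z t + δ) ^ (-q) with hh
  have hac : AbsolutelyContinuousOnInterval h 0 1 :=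
    hK₁.absolutelyContinuous_unit.fun_mul hK₂.absolutelyContinuous_unit
  have h0 : h 0 = 0 := by
    simp only [hh, hw0, abs_zero]
    rw [Real.zero_rpow (by linarith), zero_mul]
  rw [← H.integral_deriv_mul_tailFlux hz.1 hac h0, ← intervalIntegral.integral_const_mul]
  have hflux : ContinuousOn (tailFlux q B z) (uIcc 0 1) := by
    rw [uIcc_of_le zero_le_one]; exact H.continuousOn_tailFlux hz.1
  refine intervalIntegral.integral_mono_ae_restrict zero_le_one
    ((hac.intervalIntegrable_deriv.mul_continuousOn hflux).const_mul _) (H.integrable_num hw) ?_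
  refine (ae_restrict_iff' measurableSet_Icc).2 ?_
  filter_upwards [H.ae_hasDerivAt_eigenfunction hz hr heig,
    hw.absolutelyContinuous_unit.ae_differentiableAt] with t ht hwd htm
  obtain ⟨hoo, hd⟩ := ht htm
  rw [uIcc_of_le zero_le_one] at hwd
  have hwd' := (hwd htm).hasDerivAt
  set β := r⁻¹ * invSlope q A B z t with hβ
  have hβ0 : 0 ≤ β := mul_nonneg (inv_pos.2 hr).le (H.invSlope_nonneg hz htm)
  have hzδ : 0 < z t + δ := add_pos_of_nonneg_of_pos (hz.2 t htm).1 hδ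
  have hd1 : HasDerivAt (fun s => |w s| ^ (q + 1))
      ((q + 1) * |w t| ^ (q + 1 - 2) * w t * deriv w t) t :=
    (hasDerivAt_abs_rpow (w t) hq1).comp t hwd'
  have hd2 : HasDerivAt (fun s => (z s + δ) ^ (-q)) (β * (-q) * (z t + δ) ^ (-q - 1)) t :=
    (hd.add_const δ).rpow_const (Or.inl hzδ.ne')
  have hderiv : deriv h t = (q + 1) * |w t| ^ (q + 1 - 2) * w t * deriv w t * (z t + δ) ^ (-q) +
      |w t| ^ (q + 1) * (β * (-q) * (z t + δ) ^ (-q - 1)) := (hd1.mul hd2).deriv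
  have hwle : |w t| ^ (q + 1 - 2) * w t * deriv w t ≤ |w t| ^ q * |deriv w t| := by
    refine (le_abs_self _).trans_eq ?_
    rw [abs_mul, abs_mul, abs_of_nonneg (Real.rpow_nonneg (abs_nonneg _) _),
      ← Real.rpow_add_one' (abs_nonneg _) (by linarith)]
    congr 2; ring
  have hflux_eq := H.left_mul_slope_rpow hz hr hoo
  have hpow : 0 ≤ (z t + δ) ^ (-q) := Real.rpow_nonneg hzδ.le _
  have hpic := picone_pointwise hq (abs_nonneg (deriv w t)) hβ0 (abs_nonneg (w t)) hzδ
  have hA := H.left_nonneg t htm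
  have hle : deriv h t ≤ (q + 1) * (|w t| ^ q * |deriv w t|) * (z t + δ) ^ (-q) -
      |w t| ^ (q + 1) * (q * ((z t + δ) ^ (-q - 1) * β)) := by
    rw [hderiv]
    have := mul_le_mul_of_nonneg_right (mul_le_mul_of_nonneg_left hwle (by linarith : 0 ≤ q + 1))
      hpow
    linarith
  calc (r⁻¹) ^ q * (deriv h t * tailFlux q B z t) = A t * (β ^ q * deriv h t) := by
        linear_combination (-(deriv h t)) * hflux_eq
    _ ≤ A t * |deriv w t| ^ (q + 1) :=
        mul_le_mul_of_nonneg_left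
          ((mul_le_mul_of_nonneg_left hle (Real.rpow_nonneg hβ0 _)).trans hpic) hA
    _ = |deriv w t| ^ (q + 1) * A t := mul_comm _ _

/-- The eigenvalue of a positive eigenfunction bounds all Rayleigh quotients from below. -/
lemma eigenvalue_mul_le (H : WeightPair q A B L M) (hz : BoundedProfile C z) {K K' : NNReal}
    (hlip : LipschitzOnWith K z (Icc 0 1)) (hpos : ∀ t ∈ Ioc (0:ℝ) 1, 0 < z t)
    (hr : 0 < r) (heig : ∀ t ∈ Icc (0:ℝ) 1, invOp q A B z t = r * z t)
    (hw : LipschitzOnWith K' w (Icc 0 1)) (hw0 : w 0 = 0) :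
    (r⁻¹) ^ q * ∫ t in (0:ℝ)..1, |w t| ^ (q + 1) * B t ≤
      ∫ t in (0:ℝ)..1, |deriv w t| ^ (q + 1) * A t := by
  have hq := H.q_pos
  have hδ : Tendsto (fun k : ℕ => 1 / ((k:ℝ) + 1)) atTop (𝓝 0) :=
    tendsto_one_div_add_atTop_nhds_zero_nat
  have hδ0 : ∀ k : ℕ, 0 < 1 / ((k:ℝ) + 1) := fun k => Nat.one_div_pos_of_nat
  have hlim : Tendsto (fun k : ℕ => ∫ t in (0:ℝ)..1,
      |w t| ^ (q + 1) * (z t + 1 / ((k:ℝ) + 1)) ^ (-q) * (z t ^ q * B t)) atTop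
      (𝓝 (∫ t in (0:ℝ)..1, |w t| ^ (q + 1) * B t)) := by
    refine intervalIntegral.tendsto_integral_filter_of_dominated_convergence
      (fun t => |w t| ^ (q + 1) * B t) ?_ ?_ (H.integrable_den hw.continuousOn) ?_
    · refine Eventually.of_forall fun k => ?_
      refine (IntervalIntegrable.continuousOn_mul (H.integrable_flux hz.1) ?_).def'.aestronglyMeasurable
      rw [uIcc_of_le zero_le_one]
      refine (hw.continuousOn.abs.rpow_const fun x _ => Or.inr (by linarith)).mul
        ((hz.1.add continuousOn_const).rpow_const fun x hx => Or.inl ?_)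
      exact (add_pos_of_nonneg_of_pos (hz.2 x hx).1 (hδ0 k)).ne'
    · refine Eventually.of_forall fun k => Eventually.of_forall fun t ht => ?_
      rw [uIoc_of_le zero_le_one] at ht
      have ht' := Ioc_subset_Icc_self ht
      have hzt := (hz.2 t ht').1
      have hzk : 0 < z t + 1 / ((k:ℝ) + 1) := add_pos_of_nonneg_of_pos hzt (hδ0 k)
      have hB := H.right_nonneg t ht'
      have hw' : 0 ≤ |w t| ^ (q + 1) := Real.rpow_nonneg (abs_nonneg _) _
      have hratio : (z t + 1 / ((k:ℝ) + 1)) ^ (-q) * z t ^ q ≤ 1 := by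
        rw [Real.rpow_neg hzk.le, inv_mul_eq_div, div_le_one (Real.rpow_pos_of_pos hzk _)]
        exact Real.rpow_le_rpow hzt (le_add_of_nonneg_right (hδ0 k).le) hq.le
      have hn : 0 ≤ (z t + 1 / ((k:ℝ) + 1)) ^ (-q) * z t ^ q :=
        mul_nonneg (Real.rpow_nonneg hzk.le _) (Real.rpow_nonneg hzt _)
      have he : |w t| ^ (q + 1) * (z t + 1 / ((k:ℝ) + 1)) ^ (-q) * (z t ^ q * B t) =
          (|w t| ^ (q + 1) * B t) * ((z t + 1 / ((k:ℝ) + 1)) ^ (-q) * z t ^ q) := by ring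
      rw [he, Real.norm_eq_abs, abs_of_nonneg (mul_nonneg (mul_nonneg hw' hB) hn)]
      exact mul_le_of_le_one_right (mul_nonneg hw' hB) hratio
    · refine Eventually.of_forall fun t ht => ?_
      rw [uIoc_of_le zero_le_one] at ht
      have hzt := hpos t ht
      have h1 : Tendsto (fun k : ℕ => (z t + 1 / ((k:ℝ) + 1)) ^ (-q)) atTop (𝓝 (z t ^ (-q))) := by
        have := hδ.const_add (z t)
        rw [add_zero] at this
        exact this.rpow_const (Or.inl hzt.ne')
      have h2 := (h1.const_mul (|w t| ^ (q + 1))).mul_const (z t ^ q * B t)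
      have he : |w t| ^ (q + 1) * z t ^ (-q) * (z t ^ q * B t) = |w t| ^ (q + 1) * B t := by
        rw [Real.rpow_neg hzt.le]
        have := (Real.rpow_pos_of_pos hzt q).ne'
        field_simp
      rwa [he] at h2
  exact le_of_tendsto' (hlim.const_mul _) fun k =>
    H.picone_regularized hz hlip hr heig hw hw0 (hδ0 k)

/-- A positive Lipschitz minimizer of the weighted Rayleigh quotient. -/
theorem exists_minimizer (H : WeightPair q A B L M) :
    ∃ (lam : ℝ) (z : ℝ → ℝ), (∃ K, LipschitzOnWith K z (Icc 0 1)) ∧ z 0 = 0 ∧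
      (∀ t ∈ Ioc (0:ℝ) 1, 0 < z t) ∧
      (∫ t in (0:ℝ)..1, |deriv z t| ^ (q + 1) * A t =
        lam * ∫ t in (0:ℝ)..1, |z t| ^ (q + 1) * B t) ∧
      ∀ (w : ℝ → ℝ) (K : NNReal), LipschitzOnWith K w (Icc 0 1) → w 0 = 0 →
        lam * ∫ t in (0:ℝ)..1, |w t| ^ (q + 1) * B t ≤
          ∫ t in (0:ℝ)..1, |deriv w t| ^ (q + 1) * A t := by
  obtain ⟨r, hr, z, hz, hz1, heig⟩ := H.exists_eigenfunction
  have heq : ∀ t ∈ Icc (0:ℝ) 1, z t = r⁻¹ * invOp q A B z t := fun t ht => by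
    rw [heig t ht, inv_mul_cancel_left₀ hr.ne']
  have hz0 : z 0 = 0 := by rw [heq 0 (by simp), invOp_zero, mul_zero]
  have hpos : ∀ t ∈ Ioc (0:ℝ) 1, 0 < z t := fun t ht => by
    rw [heq t (Ioc_subset_Icc_self ht)]
    exact mul_pos (inv_pos.2 hr) (H.invOp_pos hz (t₁ := 1) (by simp) (by rw [hz1]; exact one_pos) ht)
  have hlip : LipschitzOnWith (Real.toNNReal (r⁻¹ * L)) z (Icc 0 1) := by
    refine LipschitzOnWith.of_dist_le_mul fun s hs t ht => ?_
    rw [Real.coe_toNNReal _ (mul_pos (inv_pos.2 hr) H.lip_pos).le]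
    have hd := H.invOp_dist_le hz hs ht
    rw [heq s hs, heq t ht, Real.dist_eq, ← mul_sub, abs_mul, abs_of_pos (inv_pos.2 hr), mul_assoc]
    rw [one_mul] at hd
    exact mul_le_mul_of_nonneg_left hd (inv_pos.2 hr).le
  exact ⟨(r⁻¹) ^ q, z, ⟨_, hlip⟩, hz0, hpos, H.eigenfunction_energy hz hlip hz0 hr heig,
    fun w K hw hw0 => H.eigenvalue_mul_le hz hlip hpos hr heig hw hw0⟩

end WeightPair

/-- Weights comparable to powers of the distance to the right endpoint form a `WeightPair`. -/
lemma exists_weightPair_of_pow {f σ : ℝ → ℝ} {a b c K p : ℝ} {k : ℕ} (hp : 2 ≤ p) (ha : 0 < a)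
    (hc : 0 < c) (hf : Measurable f) (hσ : Measurable σ)
    (hlow : ∀ t ∈ Icc (0:ℝ) 1, a * (1 - t) ^ k ≤ f t)
    (hupp : ∀ t ∈ Icc (0:ℝ) 1, f t ≤ b * (1 - t) ^ k) (hcσ : ∀ t, c ≤ σ t) (hσK : ∀ t, σ t ≤ K) :
    ∃ L M, WeightPair (p - 1) (fun t => f t * σ t ^ (1 - p)) (fun t => f t * σ t) L M := by
  have hq : 0 < p - 1 := by linarith
  have hK : 0 < K := hc.trans_le ((hcσ 0).trans (hσK 0))
  have hσ0 : ∀ t, 0 < σ t := fun t => hc.trans_le (hcσ t)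
  have hb : 0 < b := by
    have h1 := hlow 0 (by simp)
    have h2 := hupp 0 (by simp)
    simp only [sub_zero, one_pow, mul_one] at h1 h2
    linarith
  have hpw : ∀ t ∈ Icc (0:ℝ) 1, 0 ≤ (1 - t) ^ k ∧ (1 - t) ^ k ≤ 1 := fun t ht =>
    ⟨pow_nonneg (by linarith [ht.2]) _,
      pow_le_one₀ (by linarith [ht.2]) (by linarith [ht.1])⟩
  have hf0 : ∀ t ∈ Icc (0:ℝ) 1, 0 ≤ f t := fun t ht =>
    (mul_nonneg ha.le (hpw t ht).1).trans (hlow t ht)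
  have hfpos : ∀ t ∈ Ico (0:ℝ) 1, 0 < f t := fun t ht =>
    (mul_pos ha (pow_pos (by linarith [ht.2]) _)).trans_le (hlow t ⟨ht.1, ht.2.le⟩)
  have hfb : ∀ t ∈ Icc (0:ℝ) 1, f t ≤ b := fun t ht =>
    (hupp t ht).trans (mul_le_of_le_one_right hb.le (hpw t ht).2)
  have hKp : 0 < K ^ (1 - p) := Real.rpow_pos_of_pos hK _
  have hcp : 0 < c ^ (1 - p) := Real.rpow_pos_of_pos hc _
  have hBle : ∀ t ∈ Icc (0:ℝ) 1, f t * σ t ≤ b * K := fun t ht =>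
    mul_le_mul (hfb t ht) (hσK t) (hσ0 t).le hb.le
  have hD : 0 < b * K / (a * K ^ (1 - p)) := by positivity
  refine ⟨(b * K / (a * K ^ (1 - p))) ^ (p - 1)⁻¹, b * c ^ (1 - p) + b * K, ?_⟩
  refine ⟨by linarith, hf.mul (hσ.pow_const _), hf.mul hσ, Real.rpow_pos_of_pos hD _, ?_, ?_, ?_,
    ?_, ?_, ?_, ?_⟩
  · intro t ht
    have h1 : σ t ^ (1 - p) ≤ c ^ (1 - p) :=
      Real.rpow_le_rpow_of_nonpos hc (hcσ t) (by linarith)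
    have h2 : f t * σ t ^ (1 - p) ≤ b * c ^ (1 - p) :=
      mul_le_mul (hfb t ht) h1 (Real.rpow_nonneg (hσ0 t).le _) hb.le
    have : 0 < b * K := by positivity
    linarith
  · exact fun t ht => mul_nonneg (hf0 t ht) (Real.rpow_nonneg (hσ0 t).le _)
  · exact fun t ht => mul_pos (hfpos t ht) (Real.rpow_pos_of_pos (hσ0 t) _)
  · intro t ht
    have : 0 < b * c ^ (1 - p) := by positivity
    linarith [hBle t ht]
  · exact fun t ht => mul_nonneg (hf0 t ht) (hσ0 t).le
  · exact fun t ht => mul_pos (hfpos t ⟨ht.1.le, ht.2⟩) (hσ0 t)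
  · intro s hs
    have hint : IntervalIntegrable (fun t => f t * σ t) volume 0 1 :=
      intervalIntegrable_unit_of_bounded' (C := b * K)
        (hf.mul hσ).aestronglyMeasurable fun t ht => by
          rw [abs_of_nonneg (mul_nonneg (hf0 t ht) (hσ0 t).le)]
          exact hBle t ht
    have h1 : ∫ r in s..1, f r * σ r ≤ ∫ _ in s..1, b * (1 - s) ^ k * K := by
      refine intervalIntegral.integral_mono_on hs.2 (hint.sub_unit hs (by simp))
        intervalIntegrable_const fun r hr => ?_
      have hr' : r ∈ Icc (0:ℝ) 1 := ⟨hs.1.trans hr.1, hr.2⟩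
      have h2 : (1 - r) ^ k ≤ (1 - s) ^ k :=
        pow_le_pow_left₀ (by linarith [hr.2]) (by linarith [hr.1]) k
      have h3 : f r ≤ b * (1 - s) ^ k :=
        (hupp r hr').trans (mul_le_mul_of_nonneg_left h2 hb.le)
      exact mul_le_mul h3 (hσK r) (hσ0 r).le (mul_nonneg hb.le (hpw s hs).1)
    rw [intervalIntegral.integral_const, smul_eq_mul] at h1
    have h4 : (1 - s) * (b * (1 - s) ^ k * K) ≤ b * (1 - s) ^ k * K :=
      mul_le_of_le_one_left (mul_nonneg (mul_nonneg hb.le (hpw s hs).1) hK.le)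
        (by linarith [hs.1])
    have h5 : a * (1 - s) ^ k * K ^ (1 - p) ≤ f s * σ s ^ (1 - p) :=
      mul_le_mul (hlow s hs) (Real.rpow_le_rpow_of_nonpos (hσ0 s) (hσK s) (by linarith)) hKp.le
        (hf0 s hs)
    rw [Real.rpow_inv_rpow hD.le hq.ne']
    calc ∫ r in s..1, f r * σ r ≤ b * (1 - s) ^ k * K := h1.trans h4
      _ = b * K / (a * K ^ (1 - p)) * (a * (1 - s) ^ k * K ^ (1 - p)) := by field_simp
      _ ≤ _ := mul_le_mul_of_nonneg_left h5 hD.le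

/-- The Euclidean speed of a curve, truncated to the interval `[c, K]`. -/
def truncSpeed (c K : ℝ) (α : ℝ → ℝ × ℝ) (t : ℝ) : ℝ :=
  max c (min K (Real.sqrt (deriv (fun u => (α u).1) t ^ 2 + deriv (fun u => (α u).2) t ^ 2)))

lemma measurable_truncSpeed (c K : ℝ) (α : ℝ → ℝ × ℝ) : Measurable (truncSpeed c K α) :=
  measurable_const.max (measurable_const.min
    (((measurable_deriv _).pow_const 2).add ((measurable_deriv _).pow_const 2)).sqrt)

lemma ae_uIoc_mem_Ioo : ∀ᵐ t ∂(volume : Measure ℝ), t ∈ uIoc (0:ℝ) 1 → t ∈ Ioo (0:ℝ) 1 := by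
  have h : ∀ᵐ t ∂(volume : Measure ℝ), t ≠ 1 := by
    simp [ae_iff, measure_singleton]
  filter_upwards [h] with t ht ht'
  rw [uIoc_of_le zero_le_one] at ht'
  exact ⟨ht'.1, lt_of_le_of_ne ht'.2 ht⟩

lemma gSpeed_eq_sqrt_deriv (α : ℝ → ℝ × ℝ) {t : ℝ} (ht : t ∈ Ioo (0:ℝ) 1) :
    gSpeed α t =
      Real.sqrt (deriv (fun u => (α u).1) t ^ 2 + deriv (fun u => (α u).2) t ^ 2) := by
  have hn : Icc (0:ℝ) 1 ∈ 𝓝 t := Icc_mem_nhds ht.1 ht.2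
  rw [gSpeed, gSpeedOn, derivWithin_of_mem_nhds hn, derivWithin_of_mem_nhds hn]

lemma gSpeed_le_of_lipschitzOnWith {α : ℝ → ℝ × ℝ} {K : NNReal}
    (hα : LipschitzOnWith K α (Icc 0 1)) {t : ℝ} (ht : t ∈ Ioo (0:ℝ) 1) :
    gSpeed α t ≤ 2 * K := by
  have hn : Icc (0:ℝ) 1 ∈ 𝓝 t := Icc_mem_nhds ht.1 ht.2
  have h1 : LipschitzOnWith (1 * K) (fun u => (α u).1) (Icc 0 1) :=
    LipschitzWith.prod_fst.comp_lipschitzOnWith hα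
  have h2 : LipschitzOnWith (1 * K) (fun u => (α u).2) (Icc 0 1) :=
    LipschitzWith.prod_snd.comp_lipschitzOnWith hα
  rw [one_mul] at h1 h2
  have d1 := norm_deriv_le_of_lipschitzOn hn h1
  have d2 := norm_deriv_le_of_lipschitzOn hn h2
  rw [Real.norm_eq_abs] at d1 d2
  rw [gSpeed_eq_sqrt_deriv α ht]
  refine Real.sqrt_le_iff.2 ⟨by positivity, ?_⟩
  have e1 := sq_le_sq' (neg_le_of_abs_le d1) (le_of_abs_le d1)
  have e2 := sq_le_sq' (neg_le_of_abs_le d2) (le_of_abs_le d2)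
  nlinarith [sq_nonneg (K : ℝ)]

lemma ae_truncSpeed_eq_gSpeed {α : ℝ → ℝ × ℝ} {K : NNReal} {c : ℝ}
    (h0 : 0 ≤ c) (hα : LipschitzOnWith K α (Icc 0 1))
    (hspeed : ∀ᵐ t ∂(volume : Measure ℝ), t ∈ Icc (0:ℝ) 1 → c ≤ gSpeed α t) :
    ∀ᵐ t ∂(volume : Measure ℝ), t ∈ uIoc (0:ℝ) 1 → truncSpeed c (2 * K + c) α t = gSpeed α t := by
  filter_upwards [hspeed, ae_uIoc_mem_Ioo] with t h1 h2 ht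
  have ht' := h2 ht
  have hc := h1 (Ioo_subset_Icc_self ht')
  have hle := gSpeed_le_of_lipschitzOnWith hα ht'
  rw [gSpeed_eq_sqrt_deriv α ht'] at hc hle ⊢
  rw [truncSpeed]
  rw [min_eq_right (by linarith), max_eq_right hc]

/-- Power bounds for `F` along a Lipschitz curve which hits the `x`-axis. -/
lemma Fvol_bounds {n : ℕ} {cn c : ℝ} (hcn : 0 < cn) (hc : 0 < c) {α : ℝ → ℝ × ℝ} {K : NNReal}
    (hα : LipschitzOnWith K α (Icc 0 1)) (hP : ∀ t ∈ Ico (0:ℝ) 1, α t ∈ Pint)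
    (hend : α 1 ∈ Pbdry) (hu : 0 < ucoord (α 1))
    (hv : ∀ t ∈ Icc (0:ℝ) 1, c * (1 - t) ≤ vcoord (α t)) {t : ℝ} (ht : t ∈ Icc (0:ℝ) 1) :
    cn * c ^ (n - 1) * (1 - t) ^ (n - 1) ≤ Fvol n cn (α t) ∧
      Fvol n cn (α t) ≤
        cn * (((α 1).1 + K) ^ (n - 1) * K ^ (n - 1)) * (1 - t) ^ (n - 1) := by
  obtain ⟨⟨hx1, hy1⟩, hor⟩ := hend
  have hy : (α 1).2 = 0 := by
    rcases hor with h | h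
    · rw [ucoord, h] at hu
      nlinarith [sq_nonneg (α 1).2]
    · exact h
  have h01 : (0:ℝ) ≤ 1 - t := by linarith [ht.2]
  have hd := hα.dist_le_mul t ht 1 (by simp)
  rw [Prod.dist_eq, max_le_iff, Real.dist_eq, Real.dist_eq, Real.dist_eq, hy, sub_zero,
    abs_sub_comm t 1, abs_of_nonneg h01] at hd
  have hnn : 0 ≤ (α t).1 ∧ 0 ≤ (α t).2 := by
    rcases ht.2.lt_or_eq with h | h
    · have := hP t ⟨ht.1, h⟩
      exact ⟨this.1.le, this.2.le⟩
    · rw [h]; exact ⟨hx1, hy1⟩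
  have hX : (α t).1 ≤ (α 1).1 + K := by
    have h2 := (le_abs_self _).trans hd.1
    have : (K : ℝ) * (1 - t) ≤ K := mul_le_of_le_one_right K.2 (by linarith [ht.1])
    linarith
  have hY : (α t).2 ≤ K * (1 - t) := (le_abs_self _).trans hd.2
  constructor
  · calc cn * c ^ (n - 1) * (1 - t) ^ (n - 1) = cn * (c * (1 - t)) ^ (n - 1) := by
          rw [mul_pow]; ring
      _ ≤ cn * (vcoord (α t)) ^ (n - 1) :=
          mul_le_mul_of_nonneg_left (pow_le_pow_left₀ (by positivity) (hv t ht) _) hcn.le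
      _ = Fvol n cn (α t) := by rw [vcoord, Fvol, mul_pow]; ring
  · calc Fvol n cn (α t) = cn * ((α t).1 ^ (n - 1) * (α t).2 ^ (n - 1)) := by rw [Fvol]; ring
      _ ≤ cn * (((α 1).1 + K) ^ (n - 1) * (K * (1 - t)) ^ (n - 1)) := by
          refine mul_le_mul_of_nonneg_left (mul_le_mul (pow_le_pow_left₀ hnn.1 hX _)
            (pow_le_pow_left₀ hnn.2 hY _) (pow_nonneg hnn.2 _) ?_) hcn.le
          exact pow_nonneg (hnn.1.trans hX) _
      _ = _ := by rw [mul_pow]; ring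

lemma measurable_Fvol_projIcc {n : ℕ} {cn : ℝ} {α : ℝ → ℝ × ℝ} (hα : ContinuousOn α (Icc 0 1)) :
    Measurable fun t : ℝ => Fvol n cn (α (projIcc 0 1 zero_le_one t)) := by
  have h : Continuous fun t => α (projIcc (0:ℝ) 1 zero_le_one t) :=
    hα.domRestrict.comp continuous_projIcc
  have h1 := h.fst
  have h2 := h.snd
  exact Continuous.measurable ((continuous_const.mul (h1.pow _)).mul (h2.pow _))

/-- Any curve as in the theorem is governed, up to null sets, by a `WeightPair`. -/
lemma exists_weightPair_of_curve {n : ℕ} {cn : ℝ} (hcn : 0 < cn) {x0 y0 : ℝ} {α : ℝ → ℝ × ℝ}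
    (hα : MemRg x0 y0 α) (hu : 0 < ucoord (α 1)) {c : ℝ} (hc : 0 < c)
    (hspeed : ∀ᵐ t ∂(volume : Measure ℝ), t ∈ Icc (0:ℝ) 1 → c ≤ gSpeed α t)
    (hv : ∀ t ∈ Icc (0:ℝ) 1, c * (1 - t) ≤ vcoord (α t)) {p : ℝ} (hp : 2 ≤ p) :
    ∃ A B : ℝ → ℝ, ∃ L M, WeightPair (p - 1) A B L M ∧ ∀ w : ℝ → ℝ,
      (∀ᵐ t ∂(volume : Measure ℝ), t ∈ uIoc (0:ℝ) 1 →
        |deriv w t| ^ (p - 1 + 1) * A t = numG n cn p (Icc 0 1) α w t) ∧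
      (∀ᵐ t ∂(volume : Measure ℝ), t ∈ uIoc (0:ℝ) 1 →
        |w t| ^ (p - 1 + 1) * B t = denG n cn p (Icc 0 1) α w t) := by
  obtain ⟨⟨K, hK⟩, -, hend, hP⟩ := hα
  have hF : ∀ t ∈ Icc (0:ℝ) 1,
      Fvol n cn (α (projIcc 0 1 zero_le_one t)) = Fvol n cn (α t) := fun t ht => by
    rw [projIcc_of_mem zero_le_one ht]
  obtain ⟨L, M, H⟩ := exists_weightPair_of_pow (p := p) (k := n - 1) hp
    (by positivity : 0 < cn * c ^ (n - 1)) hc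
    (measurable_Fvol_projIcc (n := n) (cn := cn) hK.continuousOn)
    (measurable_truncSpeed c (2 * K + c) α)
    (fun t ht => (hF t ht).symm ▸ (Fvol_bounds hcn hc hK hP hend hu hv ht).1)
    (fun t ht => (hF t ht).symm ▸ (Fvol_bounds hcn hc hK hP hend hu hv ht).2)
    (fun t => le_max_left _ _)
    (fun t => max_le (le_add_of_nonneg_left (by positivity)) (min_le_left _ _))
  have hσ := ae_truncSpeed_eq_gSpeed hc.le hK hspeed
  refine ⟨_, _, L, M, H, fun w => ⟨?_, ?_⟩⟩
  · filter_upwards [hσ, ae_uIoc_mem_Ioo] with t h1 h2 ht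
    have ht' := h2 ht
    rw [numG, derivWithin_of_mem_nhds (Icc_mem_nhds ht'.1 ht'.2), h1 ht,
      hF t (Ioo_subset_Icc_self ht'), sub_add_cancel, mul_assoc, gSpeed]
  · filter_upwards [hσ, ae_uIoc_mem_Ioo] with t h1 h2 ht
    rw [denG, h1 ht, hF t (Ioo_subset_Icc_self (h2 ht)), sub_add_cancel, mul_assoc, gSpeed]

/-- Existence of a positive first eigenfunction: if `α ∈ R_g`
has `u(α(1)) > 0`, speed bounded below a.e. by `c > 0`, and `v(α(t)) ≥ c(1-t)`,
then for `p ≥ 2` there is a locally Lipschitz `φ` on `[0,1)` with `φ(0) = 0`,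
`φ > 0` on `(0,1)`, whose Rayleigh quotient equals `λ_{1,p}(α)`. -/
theorem simons_stmt12 (n : ℕ) (hn : 2 ≤ n) (cn : ℝ) (hcn : 0 < cn)
    (x0 y0 : ℝ) (hy0 : 0 < y0) (hxy : y0 ≤ x0)
    (α : ℝ → ℝ × ℝ) (hα : MemRg x0 y0 α) (hu : 0 < ucoord (α 1))
    (c : ℝ) (hc : 0 < c)
    (hspeed : ∀ᵐ t ∂(volume : Measure ℝ), t ∈ Icc (0:ℝ) 1 → c ≤ gSpeed α t)
    (hv : ∀ t ∈ Icc (0:ℝ) 1, c * (1 - t) ≤ vcoord (α t))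
    (p : ℝ) (hp : 2 ≤ p) :
    ∃ φ : ℝ → ℝ,
      (∀ a ∈ Ico (0:ℝ) 1, ∃ K, LipschitzOnWith K φ (Icc 0 a)) ∧
      φ 0 = 0 ∧ (∀ t ∈ Ioo (0:ℝ) 1, 0 < φ t) ∧
      IntervalIntegrable (numG n cn p (Icc 0 1) α φ) volume 0 1 ∧
      IntervalIntegrable (denG n cn p (Icc 0 1) α φ) volume 0 1 ∧
      (0 < ∫ t in (0:ℝ)..1, denG n cn p (Icc 0 1) α φ t) ∧
      (∫ t in (0:ℝ)..1, numG n cn p (Icc 0 1) α φ t) /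
        (∫ t in (0:ℝ)..1, denG n cn p (Icc 0 1) α φ t) = lambdaG n cn p α := by
  obtain ⟨A, B, L, M, H, hAB⟩ := exists_weightPair_of_curve (n := n) hcn hα hu hc hspeed hv hp
  obtain ⟨lam, z, ⟨K, hzK⟩, hz0, hzpos, hzeq, hmin⟩ := H.exists_minimizer
  have hnum : ∀ w K, LipschitzOnWith K w (Icc 0 1) →
      IntervalIntegrable (numG n cn p (Icc 0 1) α w) volume 0 1 := fun w K hw =>
    (H.integrable_num hw).congr_ae ((ae_restrict_iff' measurableSet_uIoc).2 (hAB w).1)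
  have hden : ∀ w K, LipschitzOnWith K w (Icc 0 1) →
      IntervalIntegrable (denG n cn p (Icc 0 1) α w) volume 0 1 := fun w K hw =>
    (H.integrable_den hw.continuousOn).congr_ae
      ((ae_restrict_iff' measurableSet_uIoc).2 (hAB w).2)
  have hnum_eq := fun w => intervalIntegral.integral_congr_ae (hAB w).1
  have hden_eq := fun w => intervalIntegral.integral_congr_ae (hAB w).2
  have hpos : 0 < ∫ t in (0:ℝ)..1, denG n cn p (Icc 0 1) α z t := by
    rw [← hden_eq]
    refine intervalIntegral.intervalIntegral_pos_of_pos_on (H.integrable_den hzK.continuousOn)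
      (fun t ht => ?_) zero_lt_one
    exact mul_pos (Real.rpow_pos_of_pos (abs_pos.2 (hzpos t ⟨ht.1, ht.2.le⟩).ne') _)
      (H.right_pos t ht)
  have hlam : (∫ t in (0:ℝ)..1, numG n cn p (Icc 0 1) α z t) /
      (∫ t in (0:ℝ)..1, denG n cn p (Icc 0 1) α z t) = lam := by
    rw [div_eq_iff hpos.ne', ← hnum_eq, ← hden_eq, hzeq]
  refine ⟨z, fun a ha => ⟨K, hzK.mono (Icc_subset_Icc_right ha.2.le)⟩, hz0,
    fun t ht => hzpos t ⟨ht.1, ht.2.le⟩, hnum z K hzK, hden z K hzK, hpos, ?_⟩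
  rw [hlam, lambdaG, lambdaGOn]
  symm
  refine IsLeast.csInf_eq ⟨⟨z, ⟨K, hzK⟩, hz0, hnum z K hzK, hden z K hzK, hpos, hlam.symm⟩, ?_⟩
  rintro _ ⟨w, ⟨K', hw⟩, hw0, -, -, hwpos, rfl⟩
  rw [le_div_iff₀ hwpos, ← hnum_eq, ← hden_eq]
  exact hmin w K' hw hw0
end
end

section
/- Fix p ≥ 2n−1 and set Λ_p = sup{λ_{1,p}(γ) : γ ∈ R_g}. Let α ∈ R_g^* with λ_{1,p}(α) = Λ_p. Let t₀ ∈ [0,1), let {p_k} be a sequence in [0,t₀] converging to t₀, let {q_k} be a sequence in [t₀,1) converging to t₀, and assume p_k ≠ q_k for all k. Then |α(q_k) − α(p_k)| / |q_k − p_k| → L_g(α) as k → ∞. In particular, lim_{t→t₀} |α(t) − α(t₀)| / |t − t₀| = L_g(α). -/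
open Set MeasureTheory Filter Topology

noncomputable section

/-- Bounded nonnegative measurable functions, playing the role of the slope of a test function. -/
def Slope (f : ℝ → ℝ) : Prop :=
  Measurable f ∧ (∀ t, 0 ≤ f t) ∧ ∃ K, ∀ t, f t ≤ K

/-- The test function with slope `f`. -/
def primitive (f : ℝ → ℝ) (t : ℝ) : ℝ := ∫ s in (0:ℝ)..t, f s

lemma intervalIntegrable_of_abs_le {g : ℝ → ℝ} (hg : Measurable g) {a b C : ℝ}
    (hC : ∀ t ∈ uIcc a b, |g t| ≤ C) : IntervalIntegrable g volume a b := by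
  refine (intervalIntegrable_const (c := C)).mono_fun' hg.aestronglyMeasurable ?_
  refine (ae_restrict_iff' measurableSet_uIoc).2 (Eventually.of_forall fun t ht => ?_)
  exact hC t (uIoc_subset_uIcc ht)

lemma Slope.intervalIntegrable {f : ℝ → ℝ} (hf : Slope f) (a b : ℝ) :
    IntervalIntegrable f volume a b := by
  obtain ⟨hm, h0, K, hK⟩ := hf
  exact intervalIntegrable_of_abs_le (C := K) hm fun t _ => by
    rw [abs_of_nonneg (h0 t)]; exact hK t

lemma Slope.continuous_primitive {f : ℝ → ℝ} (hf : Slope f) : Continuous (primitive f) :=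
  intervalIntegral.continuous_primitive (fun a b => hf.intervalIntegrable a b) 0

lemma Slope.primitive_mono {f : ℝ → ℝ} (hf : Slope f) : Monotone (primitive f) := by
  intro s t hst
  have h := intervalIntegral.integral_add_adjacent_intervals
    (hf.intervalIntegrable 0 s) (hf.intervalIntegrable s t)
  have h' := intervalIntegral.integral_nonneg (μ := volume) hst fun u _ => hf.2.1 u
  simp only [primitive]; linarith

lemma Slope.primitive_nonneg {f : ℝ → ℝ} (hf : Slope f) {t : ℝ} (ht : 0 ≤ t) :
    0 ≤ primitive f t :=
  intervalIntegral.integral_nonneg ht fun u _ => hf.2.1 u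

lemma intervalIntegrable_mul_of_bounded {g A : ℝ → ℝ} (hg : Measurable g) (hA : Continuous A)
    {K a b : ℝ} (hK : ∀ t ∈ uIcc a b, |g t| ≤ K) :
    IntervalIntegrable (fun t => g t * A t) volume a b := by
  obtain ⟨C, hC⟩ := (isCompact_uIcc (a := a) (b := b)).exists_bound_of_continuousOn hA.continuousOn
  refine intervalIntegrable_of_abs_le (C := K * C) (hg.mul hA.measurable) fun t ht => ?_
  rw [Pi.mul_apply, abs_mul]
  exact mul_le_mul (hK t ht) (hC t ht) (abs_nonneg _) ((abs_nonneg _).trans (hK t ht))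

lemma Slope.intervalIntegrable_rpow_mul {f A : ℝ → ℝ} (hf : Slope f) (hA : Continuous A) {p : ℝ}
    (hp : 0 ≤ p) (a b : ℝ) : IntervalIntegrable (fun t => f t ^ p * A t) volume a b := by
  obtain ⟨hm, h0, K, hK⟩ := hf
  refine intervalIntegrable_mul_of_bounded (K := K ^ p) (hm.pow_const p) hA fun t _ => ?_
  rw [abs_of_nonneg (Real.rpow_nonneg (h0 t) p)]
  exact Real.rpow_le_rpow (h0 t) (hK t) hp

lemma Slope.intervalIntegrable_primitive_rpow_mul {f B : ℝ → ℝ} (hf : Slope f) (hB : Continuous B)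
    {p : ℝ} (hp : 0 ≤ p) (a b : ℝ) :
    IntervalIntegrable (fun t => primitive f t ^ p * B t) volume a b :=
  ((hf.continuous_primitive.rpow_const fun _ => Or.inr hp).mul hB).intervalIntegrable a b

lemma integral_one_sub_rpow_neg_half :
    IntervalIntegrable (fun t : ℝ => (1 - t) ^ (-(1/2) : ℝ)) volume 0 1 ∧
    ∫ t in (0:ℝ)..1, (1 - t) ^ (-(1/2) : ℝ) = 2 := by
  constructor
  · have h := (intervalIntegral.intervalIntegrable_rpow' (a := 0) (b := 1)
      (r := (-(1/2) : ℝ)) (by norm_num)).comp_sub_left 1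
    simpa using h.symm
  · rw [intervalIntegral.integral_comp_sub_left (fun t : ℝ => t ^ (-(1/2) : ℝ)) 1]
    rw [integral_rpow (Or.inl (by norm_num))]
    norm_num

/-- Weighted Poincaré-type inequality: the energy controls the final value of the primitive. -/
lemma exists_energy_lower_bound {A : ℝ → ℝ} (hA : Continuous A) {p c : ℝ} {k : ℕ} (hc : 0 < c)
    (hk : 2 * (k : ℝ) ≤ p - 1) (hp : 1 < p) (hAc : ∀ t ∈ Icc (0:ℝ) 1, c * (1 - t) ^ k ≤ A t) :
    ∃ c₀ > 0, ∀ f, Slope f → c₀ * primitive f 1 ^ p ≤ ∫ t in (0:ℝ)..1, f t ^ p * A t := by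
  refine ⟨c / 2 * (4:ℝ)⁻¹ ^ (p - 1), by positivity, fun f hf => ?_⟩
  have hN : 0 ≤ ∫ t in (0:ℝ)..1, f t ^ p * A t := by
    refine intervalIntegral.integral_nonneg zero_le_one fun t ht => ?_
    refine mul_nonneg (Real.rpow_nonneg (hf.2.1 t) p) (le_trans ?_ (hAc t ht))
    exact mul_nonneg hc.le (pow_nonneg (by linarith [ht.2]) k)
  set W := primitive f 1 with hW
  rcases (hf.primitive_nonneg zero_le_one).eq_or_lt with h0 | hWpos
  · rw [← hW] at h0
    rw [← h0, Real.zero_rpow (by linarith), mul_zero]; exact hN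
  rw [← hW] at hWpos
  set τ := W / 4 with hτ
  have hτpos : 0 < τ := by positivity
  have hpt : ∀ t ∈ Ioo (0:ℝ) 1,
      f t ≤ τ * (1 - t) ^ (-(1/2) : ℝ) + (τ ^ (p - 1) * c)⁻¹ * (f t ^ p * A t) := by
    intro t ht
    have h1t : 0 < 1 - t := by linarith [ht.2]
    have hA0 : c * (1 - t) ^ k ≤ A t := hAc t (Ioo_subset_Icc_self ht)
    have hApos : 0 < A t := lt_of_lt_of_le (by positivity) hA0
    have hft := hf.2.1 t
    rcases le_or_gt (f t) (τ * (1 - t) ^ (-(1/2) : ℝ)) with h | h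
    · have : 0 ≤ (τ ^ (p - 1) * c)⁻¹ * (f t ^ p * A t) := by positivity
      linarith
    · have hfpos : 0 < f t := lt_trans (by positivity) h
      have h1 : (τ * (1 - t) ^ (-(1/2) : ℝ)) ^ (p - 1) ≤ f t ^ (p - 1) :=
        Real.rpow_le_rpow (by positivity) h.le (by linarith)
      rw [Real.mul_rpow hτpos.le (by positivity), ← Real.rpow_mul h1t.le] at h1
      have h2 : (1:ℝ) ≤ (1 - t) ^ (-(1/2) * (p - 1) : ℝ) * (1 - t) ^ k := by
        rw [← Real.rpow_natCast, ← Real.rpow_add h1t]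
        exact Real.one_le_rpow_of_pos_of_le_one_of_nonpos h1t (by linarith [ht.1]) (by linarith)
      have h3 : τ ^ (p - 1) * c ≤ f t ^ (p - 1) * A t := by
        calc τ ^ (p - 1) * c = τ ^ (p - 1) * c * 1 := by ring
          _ ≤ τ ^ (p - 1) * c * ((1 - t) ^ (-(1/2) * (p - 1) : ℝ) * (1 - t) ^ k) := by gcongr
          _ = (τ ^ (p - 1) * (1 - t) ^ (-(1/2) * (p - 1) : ℝ)) * (c * (1 - t) ^ k) := by ring
          _ ≤ f t ^ (p - 1) * A t := by gcongr
      have h4 : f t ^ p = f t * f t ^ (p - 1) := by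
        rw [← Real.rpow_one_add' hft (by linarith)]; congr 1; ring
      have h5 : f t ≤ (τ ^ (p - 1) * c)⁻¹ * (f t ^ p * A t) := by
        rw [inv_mul_eq_div, le_div_iff₀ (by positivity), h4]
        nlinarith
      have : 0 ≤ τ * (1 - t) ^ (-(1/2) : ℝ) := by positivity
      linarith
  obtain ⟨hgi, hg2⟩ := integral_one_sub_rpow_neg_half
  have hfA := hf.intervalIntegrable_rpow_mul hA (by linarith : 0 ≤ p) 0 1
  have hint := intervalIntegral.integral_mono_on_of_le_Ioo zero_le_one
    (hf.intervalIntegrable 0 1) ((hgi.const_mul τ).add (hfA.const_mul _)) hpt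
  rw [intervalIntegral.integral_add (hgi.const_mul τ) (hfA.const_mul _),
    intervalIntegral.integral_const_mul, intervalIntegral.integral_const_mul, hg2] at hint
  change W ≤ _ at hint
  have h6 : W / 2 ≤ (τ ^ (p - 1) * c)⁻¹ * ∫ t in (0:ℝ)..1, f t ^ p * A t := by
    rw [hτ] at hint ⊢; linarith
  rw [inv_mul_eq_div, le_div_iff₀ (by positivity)] at h6
  have h7 : W ^ p = W * W ^ (p - 1) := by
    rw [← Real.rpow_one_add' hWpos.le (by linarith)]; congr 1; ring
  rw [hτ, div_eq_mul_inv W 4, Real.mul_rpow hWpos.le (by norm_num)] at h6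
  rw [h7]; linarith

/-- A nonzero increasing function keeps a definite fraction of its weighted mass on `[b, 1]`. -/
lemma exists_tail_mass {B : ℝ → ℝ} (hB : Continuous B) (hB0 : ∀ t ∈ Icc (0:ℝ) 1, 0 ≤ B t)
    (hBpos : ∀ t ∈ Ico (0:ℝ) 1, 0 < B t) {b p : ℝ} (hb0 : 0 < b) (hb : b < 1) (hp0 : 0 ≤ p) :
    ∃ c > 0, ∀ f, Slope f → c * (∫ t in (0:ℝ)..1, primitive f t ^ p * B t) ≤
      ∫ t in b..(1:ℝ), primitive f t ^ p * B t := by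
  set P := ∫ t in (0:ℝ)..b, B t with hP
  set Q := ∫ t in b..(1:ℝ), B t with hQ
  have hP0 : 0 ≤ P := intervalIntegral.integral_nonneg hb0.le fun t ht =>
    hB0 t ⟨ht.1, ht.2.trans hb.le⟩
  have hQ0 : 0 < Q := intervalIntegral.intervalIntegral_pos_of_pos_on (hB.intervalIntegrable _ _)
    (fun t ht => hBpos t ⟨hb0.le.trans ht.1.le, ht.2⟩) hb
  refine ⟨Q / (P + Q), by positivity, fun f hf => ?_⟩
  have hfB := fun a b => hf.intervalIntegrable_primitive_rpow_mul hB hp0 a b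
  have hX : (∫ t in (0:ℝ)..b, primitive f t ^ p * B t) ≤ primitive f b ^ p * P := by
    rw [hP, ← intervalIntegral.integral_const_mul]
    refine intervalIntegral.integral_mono_on hb0.le (hfB _ _)
      ((hB.intervalIntegrable _ _).const_mul _) fun t ht => ?_
    have := hB0 t ⟨ht.1, ht.2.trans hb.le⟩
    have h1 := hf.primitive_nonneg ht.1
    have h2 := hf.primitive_mono ht.2
    gcongr
  have hY : primitive f b ^ p * Q ≤ ∫ t in b..(1:ℝ), primitive f t ^ p * B t := by
    rw [hQ, ← intervalIntegral.integral_const_mul]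
    refine intervalIntegral.integral_mono_on hb.le
      ((hB.intervalIntegrable _ _).const_mul _) (hfB _ _) fun t ht => ?_
    have := hB0 t ⟨hb0.le.trans ht.1, ht.2⟩
    have h1 := hf.primitive_nonneg hb0.le
    have h2 := hf.primitive_mono ht.1
    gcongr
  rw [← intervalIntegral.integral_add_adjacent_intervals (hfB 0 b) (hfB b 1), div_mul_eq_mul_div,
    div_le_iff₀ (by positivity)]
  nlinarith [mul_le_mul_of_nonneg_right hX hQ0.le, mul_le_mul_of_nonneg_right hY hP0]

lemma measurable_indicator_Icc (a b : ℝ) : Measurable ((Icc a b).indicator (1 : ℝ → ℝ)) :=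
  measurable_one.indicator measurableSet_Icc

lemma indicator_Icc_nonneg (a b t : ℝ) : 0 ≤ (Icc a b).indicator (1 : ℝ → ℝ) t :=
  indicator_nonneg (fun _ _ => zero_le_one) t

lemma indicator_Icc_le_one (a b t : ℝ) : (Icc a b).indicator (1 : ℝ → ℝ) t ≤ 1 :=
  indicator_le_self' (fun _ _ => zero_le_one) t

lemma slope_indicator (a b : ℝ) : Slope ((Icc a b).indicator 1) :=
  ⟨measurable_indicator_Icc a b, indicator_Icc_nonneg a b, 1, indicator_Icc_le_one a b⟩

lemma le_primitive_indicator {a b : ℝ} (ha : 0 ≤ a) (hab : a ≤ b) :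
    b - a ≤ primitive ((Icc a b).indicator 1) b := by
  have hJs := slope_indicator a b
  set J : ℝ → ℝ := (Icc a b).indicator 1 with hJ
  have h := intervalIntegral.integral_add_adjacent_intervals
    (hJs.intervalIntegrable 0 a) (hJs.intervalIntegrable a b)
  have h1 : ∫ t in a..b, J t = ∫ _ in a..b, (1:ℝ) := by
    refine intervalIntegral.integral_congr fun t ht => ?_
    rw [uIcc_of_le hab] at ht
    simp [hJ, ht]
  have h2 := hJs.primitive_nonneg ha
  simp only [primitive] at h2 ⊢
  rw [h1] at h
  simp at h; linarith

lemma Slope.intervalIntegrable_indicator_mul {f A : ℝ → ℝ} (hf : Slope f) (hA : Continuous A)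
    {p : ℝ} (hp0 : 0 ≤ p) (a b : ℝ) :
    IntervalIntegrable (fun t => (Icc a b).indicator 1 t * f t ^ p * A t) volume 0 1 := by
  obtain ⟨hfm, hf0, K, hK⟩ := hf
  refine intervalIntegrable_mul_of_bounded (g := fun t => (Icc a b).indicator 1 t * f t ^ p)
    (K := 1 * K ^ p) ((measurable_indicator_Icc a b).mul (hfm.pow_const p)) hA fun t _ => ?_
  rw [abs_of_nonneg (mul_nonneg (indicator_Icc_nonneg a b t) (Real.rpow_nonneg (hf0 t) p))]
  exact mul_le_mul (indicator_Icc_le_one a b t) (Real.rpow_le_rpow (hf0 t) (hK t) hp0)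
    (Real.rpow_nonneg (hf0 t) p) zero_le_one

lemma Slope.add_indicator {f : ℝ → ℝ} (hf : Slope f) {h : ℝ} (hh0 : 0 ≤ h) (a b : ℝ) :
    Slope (fun t => f t + h * (Icc a b).indicator 1 t) := by
  obtain ⟨hfm, hf0, K, hK⟩ := hf
  refine ⟨hfm.add ((measurable_indicator_Icc a b).const_mul h),
    fun t => add_nonneg (hf0 t) (mul_nonneg hh0 (indicator_Icc_nonneg a b t)), K + h * 1,
    fun t => add_le_add (hK t) (mul_le_mul_of_nonneg_left (indicator_Icc_le_one a b t) hh0)⟩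

lemma Slope.primitive_add_indicator {f : ℝ → ℝ} (hf : Slope f) (h a b t : ℝ) :
    primitive (fun t => f t + h * (Icc a b).indicator 1 t) t =
      primitive f t + h * primitive ((Icc a b).indicator 1) t := by
  simp only [primitive]
  rw [intervalIntegral.integral_add (hf.intervalIntegrable 0 t)
    (((slope_indicator a b).intervalIntegrable 0 t).const_mul h),
    intervalIntegral.integral_const_mul]

lemma add_rpow_le_two_rpow_mul {x y p : ℝ} (hx : 0 ≤ x) (hy : 0 ≤ y) (hp : 1 ≤ p) :
    (x + y) ^ p ≤ 2 ^ (p - 1) * (x ^ p + y ^ p) := by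
  lift x to NNReal using hx
  lift y to NNReal using hy
  exact_mod_cast NNReal.rpow_add_le_mul_rpow_add_rpow x y hp

lemma Slope.energy_add_indicator_le {f A : ℝ → ℝ} (hf : Slope f) (hA : Continuous A)
    (hA0 : ∀ t ∈ Icc (0:ℝ) 1, 0 ≤ A t) {C h p : ℝ} (hC' : ∀ t ∈ Icc (0:ℝ) 1, A t ≤ C)
    (hh0 : 0 ≤ h) (hp : 1 ≤ p) (a b : ℝ) :
    (∫ t in (0:ℝ)..1, (f t + h * (Icc a b).indicator 1 t) ^ p * A t) ≤
      (∫ t in (0:ℝ)..1, f t ^ p * A t) +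
        2 ^ (p - 1) * (∫ t in (0:ℝ)..1, (Icc a b).indicator 1 t * f t ^ p * A t) +
        2 ^ (p - 1) * (h ^ p * C) := by
  have hp0 : 0 ≤ p := by linarith
  have hC0 : 0 ≤ C := (hA0 0 (by simp)).trans (hC' 0 (by simp))
  have hfA := hf.intervalIntegrable_rpow_mul hA hp0
  have hgA := (hf.add_indicator hh0 a b).intervalIntegrable_rpow_mul hA hp0
  have hJfA := hf.intervalIntegrable_indicator_mul hA hp0 a b
  have hf0 := hf.2.1
  set J : ℝ → ℝ := (Icc a b).indicator 1 with hJ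
  set T : ℝ := 2 ^ (p - 1) with hT
  have hT0 : 0 < T := by positivity
  have : ∀ t ∈ Icc (0:ℝ) 1, (f t + h * J t) ^ p * A t ≤
      (f t ^ p * A t + T * (J t * f t ^ p * A t)) + T * (h ^ p * C) := by
    intro t ht
    have hA0t := hA0 t ht
    have hfp := Real.rpow_nonneg (hf0 t) p
    have hhp := Real.rpow_nonneg hh0 p
    by_cases htI : t ∈ Icc a b
    · have hJt : J t = 1 := by simp [hJ, htI]
      simp only [hJt, mul_one, one_mul]
      have h1 : (f t + h) ^ p ≤ T * (f t ^ p + h ^ p) :=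
        add_rpow_le_two_rpow_mul (hf0 t) hh0 hp
      have h2 : h ^ p * A t ≤ h ^ p * C := mul_le_mul_of_nonneg_left (hC' t ht) hhp
      calc (f t + h) ^ p * A t ≤ T * (f t ^ p + h ^ p) * A t := by gcongr
        _ = T * (f t ^ p * A t) + T * (h ^ p * A t) := by ring
        _ ≤ T * (f t ^ p * A t) + T * (h ^ p * C) := by gcongr
        _ ≤ _ := by
          have : 0 ≤ f t ^ p * A t := by positivity
          linarith
    · have hJt : J t = 0 := by simp [hJ, htI]
      simp only [hJt, mul_zero, zero_mul, add_zero]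
      have : 0 ≤ T * (h ^ p * C) := by positivity
      linarith
  have := intervalIntegral.integral_mono_on zero_le_one (hgA 0 1)
    (((hfA 0 1).add (hJfA.const_mul T)).add (intervalIntegrable_const)) this
  rw [intervalIntegral.integral_add ((hfA 0 1).add (hJfA.const_mul T))
    intervalIntegrable_const, intervalIntegral.integral_add (hfA 0 1) (hJfA.const_mul T),
    intervalIntegral.integral_const_mul, intervalIntegral.integral_const] at this
  simpa using this

/-- If `s` is a subinterval away from the endpoint `1`, adding weight to the energy on `s` strictly
raises the optimal constant in a weighted Poincaré inequality. -/
lemma exists_gap {A B : ℝ → ℝ} (hA : Continuous A) (hB : Continuous B)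
    (hA0 : ∀ t ∈ Icc (0:ℝ) 1, 0 ≤ A t) (hB0 : ∀ t ∈ Icc (0:ℝ) 1, 0 ≤ B t)
    (hBpos : ∀ t ∈ Ico (0:ℝ) 1, 0 < B t) {a b p c₀ η l : ℝ} (ha : 0 ≤ a) (hab : a < b)
    (hb : b < 1) (hp : 2 ≤ p) (hc₀ : 0 < c₀)
    (hlow : ∀ f, Slope f → c₀ * primitive f 1 ^ p ≤ ∫ t in (0:ℝ)..1, f t ^ p * A t)
    (hη : 0 < η) (hl : 0 < l)
    (hopt : ∀ f, Slope f → l * (∫ t in (0:ℝ)..1, primitive f t ^ p * B t) ≤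
      ∫ t in (0:ℝ)..1, f t ^ p * A t) :
    ∃ σ > 1, ∀ f, Slope f → σ * (l * ∫ t in (0:ℝ)..1, primitive f t ^ p * B t) ≤
      (∫ t in (0:ℝ)..1, f t ^ p * A t) +
        η * ∫ t in (0:ℝ)..1, (Icc a b).indicator 1 t * f t ^ p * A t := by
  have hp0 : 0 ≤ p := by linarith
  have hb0 : 0 < b := ha.trans_lt hab
  set J : ℝ → ℝ := (Icc a b).indicator 1 with hJ
  have hJs : Slope J := slope_indicator a b
  have hJb : b - a ≤ primitive J b := le_primitive_indicator ha hab.le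
  obtain ⟨C, hC⟩ := (isCompact_Icc (a := (0:ℝ)) (b := 1)).exists_bound_of_continuousOn
    hA.continuousOn
  have hC' : ∀ t ∈ Icc (0:ℝ) 1, A t ≤ C := fun t ht => (le_abs_self _).trans (hC t ht)
  have hC0 : 0 ≤ C := (hA0 0 (by simp)).trans (hC' 0 (by simp))
  obtain ⟨c₁, hc₁0, hc₁⟩ := exists_tail_mass hB hB0 hBpos hb0 hb hp0
  set T : ℝ := 2 ^ (p - 1) with hT
  have hT0 : 0 < T := by positivity
  set E := T * ((b - a)⁻¹ ^ p * C) / c₀ with hE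
  have hba : 0 < b - a := sub_pos.2 hab
  have hE0 : 0 ≤ E := by positivity
  set κ := min 1 (c₁ / (E + 1)) with hκ
  have hκ0 : 0 < κ := by positivity
  have hκp : E * κ ^ p < p * κ * c₁ := by
    have h1 : κ ^ p ≤ κ ^ 2 := by
      rw [← Real.rpow_two]
      exact Real.rpow_le_rpow_of_exponent_ge hκ0 (min_le_left _ _) hp
    have h2 : κ * (E + 1) ≤ c₁ := (le_div_iff₀ (by positivity)).1 (min_le_right _ _)
    have h3 : E * κ ^ p ≤ E * κ ^ 2 := by gcongr
    have h4 : E * κ < p * c₁ := by nlinarith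
    nlinarith
  have key : ∀ f, Slope f → (1 + p * κ * c₁) * (l * ∫ t in (0:ℝ)..1, primitive f t ^ p * B t) ≤
      (1 + E * κ ^ p) * (∫ t in (0:ℝ)..1, f t ^ p * A t) +
        T * ∫ t in (0:ℝ)..1, J t * f t ^ p * A t := by
    intro f hf
    set W := primitive f 1 with hW
    have hW0 : 0 ≤ W := hf.primitive_nonneg zero_le_one
    have hfB := fun a b => hf.intervalIntegrable_primitive_rpow_mul hB hp0 a b
    set h := κ * W / (b - a) with hh
    have hh0 : 0 ≤ h := by positivity
    set g : ℝ → ℝ := fun t => f t + h * J t with hg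
    have hgs : Slope g := hf.add_indicator hh0 a b
    have hgp := hf.primitive_add_indicator h a b
    have hgB := fun a b => hgs.intervalIntegrable_primitive_rpow_mul hB hp0 a b
    have hnum := hf.energy_add_indicator_le hA hA0 hC' hh0 (by linarith : 1 ≤ p) a b
    have hd1 : (∫ t in (0:ℝ)..b, primitive f t ^ p * B t) ≤
        ∫ t in (0:ℝ)..b, primitive g t ^ p * B t := by
      refine intervalIntegral.integral_mono_on hb0.le (hfB _ _) (hgB _ _) fun t ht => ?_
      have := hB0 t ⟨ht.1, ht.2.trans hb.le⟩
      have h1 := hf.primitive_nonneg ht.1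
      have h2 : primitive f t ≤ primitive g t := by
        rw [hg, hgp]; have := mul_nonneg hh0 (hJs.primitive_nonneg ht.1); linarith
      gcongr
    have hd2 : (1 + p * κ) * (∫ t in b..(1:ℝ), primitive f t ^ p * B t) ≤
        ∫ t in b..(1:ℝ), primitive g t ^ p * B t := by
      rw [← intervalIntegral.integral_const_mul]
      refine intervalIntegral.integral_mono_on hb.le ((hfB _ _).const_mul _) (hgB _ _)
        fun t ht => ?_
      have ht0 : 0 ≤ t := hb0.le.trans ht.1
      have := hB0 t ⟨ht0, ht.2⟩
      have h1 := hf.primitive_nonneg ht0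
      have h2 : primitive f t ≤ W := hf.primitive_mono ht.2
      have h3 : (1 + κ) * primitive f t ≤ primitive g t := by
        have h4 : b - a ≤ primitive J t := hJb.trans (hJs.primitive_mono ht.1)
        have h5 : h * (b - a) ≤ h * primitive J t := mul_le_mul_of_nonneg_left h4 hh0
        have h6 : h * (b - a) = κ * W := by rw [hh]; field_simp
        rw [hg, hgp]
        nlinarith
      have h4 : 1 + p * κ ≤ (1 + κ) ^ p :=
        one_add_mul_self_le_rpow_one_add (by linarith) (by linarith)
      have h5 : (1 + p * κ) * primitive f t ^ p ≤ primitive g t ^ p := by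
        calc (1 + p * κ) * primitive f t ^ p ≤ (1 + κ) ^ p * primitive f t ^ p := by gcongr
          _ = ((1 + κ) * primitive f t) ^ p := (Real.mul_rpow (by positivity) h1).symm
          _ ≤ _ := by gcongr
      rw [← mul_assoc]; gcongr
    have hsplit := intervalIntegral.integral_add_adjacent_intervals (hfB 0 b) (hfB b 1)
    have hsplit' := intervalIntegral.integral_add_adjacent_intervals (hgB 0 b) (hgB b 1)
    set X := ∫ t in (0:ℝ)..b, primitive f t ^ p * B t
    set Y := ∫ t in b..(1:ℝ), primitive f t ^ p * B t
    have hc₁Y := hc₁ f hf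
    rw [← hsplit] at hc₁Y
    have hD : (1 + p * κ * c₁) * (X + Y) ≤ ∫ t in (0:ℝ)..1, primitive g t ^ p * B t := by
      have : 0 ≤ p * κ := by positivity
      nlinarith [mul_le_mul_of_nonneg_left hc₁Y this]
    have hopt' := hopt g hgs
    have hhp : T * (h ^ p * C) = E * κ ^ p * (c₀ * W ^ p) := by
      rw [hh, div_eq_mul_inv, Real.mul_rpow (by positivity) (by positivity),
        Real.mul_rpow hκ0.le hW0, hE]
      field_simp
    have hlow' := mul_le_mul_of_nonneg_left (hlow f hf) (by positivity : 0 ≤ E * κ ^ p)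
    rw [← hsplit]
    have := mul_le_mul_of_nonneg_left hD hl.le
    linarith
  set x := 1 + p * κ * c₁ with hx
  set y := 1 + E * κ ^ p with hy
  have hy0 : 0 < y := by positivity
  set θ := min (η / T) (1 / y) with hθ
  have hθ0 : 0 < θ := by positivity
  have hθT : θ * T ≤ η := (le_div_iff₀ hT0).1 (min_le_left _ _)
  have hθy : θ * y ≤ 1 := (le_div_iff₀ hy0).1 (min_le_right _ _)
  refine ⟨1 + θ * (x - y), by nlinarith [mul_pos hθ0 (by linarith : 0 < x - y)], fun f hf => ?_⟩
  have h1 := mul_le_mul_of_nonneg_left (key f hf) hθ0.le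
  have h2 := mul_le_mul_of_nonneg_left (hopt f hf) (sub_nonneg.2 hθy)
  have h3 : 0 ≤ ∫ t in (0:ℝ)..1, J t * f t ^ p * A t :=
    intervalIntegral.integral_nonneg zero_le_one fun t ht =>
      mul_nonneg (mul_nonneg (indicator_Icc_nonneg a b t) (Real.rpow_nonneg (hf.2.1 t) p))
        (hA0 t ht)
  have h4 := mul_le_mul_of_nonneg_right hθT h3
  linarith

/-- The projection of `ℝ` onto `[0, 1]`. -/
def clampUnit (t : ℝ) : ℝ := max 0 (min 1 t)

lemma clampUnit_mem (t : ℝ) : clampUnit t ∈ Icc (0:ℝ) 1 :=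
  ⟨le_max_left _ _, max_le zero_le_one (min_le_left _ _)⟩

lemma clampUnit_of_mem {t : ℝ} (ht : t ∈ Icc (0:ℝ) 1) : clampUnit t = t := by
  simp [clampUnit, ht.1, ht.2]

lemma lipschitzWith_clampUnit : LipschitzWith 1 clampUnit :=
  (LipschitzWith.id.const_min 1).const_max 0

lemma LipschitzOnWith.comp_clampUnit {X : Type*} [PseudoEMetricSpace X] {w : ℝ → X} {K : NNReal}
    (hw : LipschitzOnWith K w (Icc 0 1)) : LipschitzWith K (w ∘ clampUnit) := by
  rw [← lipschitzOnWith_univ, ← mul_one K]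
  exact hw.comp (lipschitzWith_clampUnit.lipschitzOnWith) fun t _ => clampUnit_mem t

lemma comp_clampUnit_eventuallyEq {X : Type*} (w : ℝ → X) {t : ℝ} (ht : t ∈ Ioo (0:ℝ) 1) :
    w ∘ clampUnit =ᶠ[𝓝 t] w := by
  filter_upwards [Ioo_mem_nhds ht.1 ht.2] with s hs
  simp [clampUnit_of_mem (Ioo_subset_Icc_self hs)]

lemma derivWithin_Icc_eq_deriv {w : ℝ → ℝ} {t : ℝ} (ht : t ∈ Ioo (0:ℝ) 1) :
    derivWithin w (Icc 0 1) t = deriv w t :=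
  derivWithin_of_mem_nhds (Icc_mem_nhds ht.1 ht.2)

lemma derivWithin_eq_deriv_comp_clampUnit {w : ℝ → ℝ} {t : ℝ} (ht : t ∈ Ioo (0:ℝ) 1) :
    derivWithin w (Icc 0 1) t = deriv (w ∘ clampUnit) t := by
  rw [derivWithin_Icc_eq_deriv ht, (comp_clampUnit_eventuallyEq w ht).deriv_eq]

lemma ae_mem_uIoc_of_ae_mem_Ioo {P : ℝ → Prop}
    (h : ∀ᵐ t ∂(volume : Measure ℝ), t ∈ Ioo (0:ℝ) 1 → P t) :
    ∀ᵐ t ∂(volume : Measure ℝ), t ∈ uIoc (0:ℝ) 1 → P t := by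
  filter_upwards [h, Measure.ae_ne volume (1:ℝ)] with t ht h1 hm
  rw [uIoc_of_le zero_le_one] at hm
  exact ht ⟨hm.1, lt_of_le_of_ne hm.2 h1⟩

lemma integral_mono_of_ae_Ioo {f g : ℝ → ℝ} (hf : IntervalIntegrable f volume 0 1)
    (hg : IntervalIntegrable g volume 0 1)
    (h : ∀ᵐ t ∂(volume : Measure ℝ), t ∈ Ioo (0:ℝ) 1 → f t ≤ g t) :
    ∫ t in (0:ℝ)..1, f t ≤ ∫ t in (0:ℝ)..1, g t := by
  refine intervalIntegral.integral_mono_ae_restrict zero_le_one hf hg ?_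
  rw [← restrict_Ioo_eq_restrict_Icc]
  exact (ae_restrict_iff' measurableSet_Ioo).2 h

lemma intervalIntegrable_congr_of_ae_Ioo {f g : ℝ → ℝ} (hf : IntervalIntegrable f volume 0 1)
    (h : ∀ᵐ t ∂(volume : Measure ℝ), t ∈ Ioo (0:ℝ) 1 → f t = g t) :
    IntervalIntegrable g volume 0 1 :=
  hf.congr_ae ((ae_restrict_iff' measurableSet_uIoc).2 (ae_mem_uIoc_of_ae_mem_Ioo h))

lemma integral_congr_of_ae_Ioo {f g : ℝ → ℝ}
    (h : ∀ᵐ t ∂(volume : Measure ℝ), t ∈ Ioo (0:ℝ) 1 → f t = g t) :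
    ∫ t in (0:ℝ)..1, f t = ∫ t in (0:ℝ)..1, g t :=
  intervalIntegral.integral_congr_ae (ae_mem_uIoc_of_ae_mem_Ioo h)

lemma slope_abs_deriv {g : ℝ → ℝ} {K : NNReal} (hg : LipschitzWith K g) :
    Slope fun t => |deriv g t| :=
  ⟨(measurable_deriv g).abs, fun _ => abs_nonneg _, K, fun _ =>
    norm_deriv_le_of_lipschitz hg⟩

lemma LipschitzWith.integral_deriv {g : ℝ → ℝ} {K : NNReal} (hg : LipschitzWith K g) (a b : ℝ) :
    ∫ t in a..b, deriv g t = g b - g a :=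
  (hg.lipschitzOnWith.absolutelyContinuousOnInterval).integral_deriv_eq_sub

lemma abs_le_primitive_abs_deriv {g : ℝ → ℝ} {K : NNReal} (hg : LipschitzWith K g)
    (h0 : g 0 = 0) {t : ℝ} (ht : 0 ≤ t) : |g t| ≤ primitive (fun t => |deriv g t|) t := by
  have h := hg.integral_deriv 0 t
  rw [h0, sub_zero] at h
  rw [← h]
  exact intervalIntegral.abs_integral_le_integral_abs ht

lemma Slope.lipschitzOnWith_primitive {f : ℝ → ℝ} (hf : Slope f) :
    ∃ K, LipschitzOnWith K (primitive f) (Icc 0 1) := by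
  obtain ⟨hm, h0, K, hK⟩ := id hf
  refine ⟨K.toNNReal, LipschitzOnWith.of_dist_le_mul fun s _ t _ => ?_⟩
  rw [Real.coe_toNNReal _ ((h0 0).trans (hK 0)), dist_eq_norm, Real.dist_eq]
  simp only [primitive]
  rw [intervalIntegral.integral_interval_sub_left (hf.intervalIntegrable 0 s)
    (hf.intervalIntegrable 0 t)]
  exact intervalIntegral.norm_integral_le_of_norm_le_const fun u _ => by
    rw [Real.norm_eq_abs, abs_of_nonneg (h0 u)]; exact hK u

lemma Slope.ae_derivWithin_primitive {f : ℝ → ℝ} (hf : Slope f) :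
    ∀ᵐ t ∂(volume : Measure ℝ), t ∈ Ioo (0:ℝ) 1 →
      derivWithin (primitive f) (Icc 0 1) t = f t := by
  filter_upwards [(hf.intervalIntegrable 0 1).ae_hasDerivAt_integral] with t ht hm
  rw [derivWithin_Icc_eq_deriv hm]
  exact (ht (by rw [uIcc_of_le zero_le_one]; exact Ioo_subset_Icc_self hm) 0
    left_mem_uIcc).deriv

/-- A weighted Poincaré inequality for slopes bounds `lambdaG` from below. -/
lemma le_lambdaG {n : ℕ} {cn p μ : ℝ} {β : ℝ → ℝ × ℝ} {A B : ℝ → ℝ} (hp : 0 ≤ p)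
    (hμ : 0 ≤ μ) (hB : Continuous B)
    (hne : {q | ∃ w : ℝ → ℝ, (∃ K, LipschitzOnWith K w (Icc 0 1)) ∧ w 0 = 0 ∧
      IntervalIntegrable (numG n cn p (Icc 0 1) β w) volume 0 1 ∧
      IntervalIntegrable (denG n cn p (Icc 0 1) β w) volume 0 1 ∧
      (0 < ∫ t in (0:ℝ)..1, denG n cn p (Icc 0 1) β w t) ∧
      q = (∫ t in (0:ℝ)..1, numG n cn p (Icc 0 1) β w t) /
        (∫ t in (0:ℝ)..1, denG n cn p (Icc 0 1) β w t)}.Nonempty)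
    (hnum : ∀ᵐ t ∂(volume : Measure ℝ), t ∈ Ioo (0:ℝ) 1 →
      A t ≤ Fvol n cn (β t) * gSpeed β t ^ (1 - p))
    (hden : ∀ᵐ t ∂(volume : Measure ℝ), t ∈ Ioo (0:ℝ) 1 →
      0 ≤ Fvol n cn (β t) * gSpeed β t ∧ Fvol n cn (β t) * gSpeed β t ≤ B t)
    (hint : ∀ f, Slope f → IntervalIntegrable (fun t => f t ^ p * A t) volume 0 1)
    (hopt : ∀ f, Slope f → μ * (∫ t in (0:ℝ)..1, primitive f t ^ p * B t) ≤
      ∫ t in (0:ℝ)..1, f t ^ p * A t) :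
    μ ≤ lambdaG n cn p β := by
  refine le_csInf hne ?_
  rintro q ⟨w, ⟨K, hw⟩, hw0, hiN, hiD, hpos, rfl⟩
  rw [le_div_iff₀ hpos]
  have hg := hw.comp_clampUnit
  have hf := slope_abs_deriv hg
  set f := fun t => |deriv (w ∘ clampUnit) t| with hfdef
  have hN : ∫ t in (0:ℝ)..1, f t ^ p * A t ≤ ∫ t in (0:ℝ)..1, numG n cn p (Icc 0 1) β w t := by
    refine integral_mono_of_ae_Ioo (hint f hf) hiN ?_
    filter_upwards [hnum] with t ht hm
    simp only [numG]
    rw [derivWithin_eq_deriv_comp_clampUnit hm, mul_assoc]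
    exact mul_le_mul_of_nonneg_left (ht hm) (Real.rpow_nonneg (abs_nonneg _) p)
  have hD : ∫ t in (0:ℝ)..1, denG n cn p (Icc 0 1) β w t ≤
      ∫ t in (0:ℝ)..1, primitive f t ^ p * B t := by
    refine integral_mono_of_ae_Ioo hiD (hf.intervalIntegrable_primitive_rpow_mul hB hp 0 1) ?_
    filter_upwards [hden] with t ht hm
    simp only [denG]
    rw [mul_assoc]
    have h1 := abs_le_primitive_abs_deriv hg (by simp [clampUnit, hw0]) hm.1.le
    rw [Function.comp, clampUnit_of_mem (Ioo_subset_Icc_self hm)] at h1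
    exact mul_le_mul (Real.rpow_le_rpow (abs_nonneg _) h1 hp) (ht hm).2 (ht hm).1
      (Real.rpow_nonneg (hf.primitive_nonneg hm.1.le) p)
  exact (mul_le_mul_of_nonneg_left hD hμ).trans ((hopt f hf).trans hN)

/-- `lambdaG` satisfies the Poincaré inequality for slopes. -/
lemma lambdaG_mul_le {n : ℕ} {cn p : ℝ} {α : ℝ → ℝ × ℝ} {A B : ℝ → ℝ} (hp : 0 ≤ p)
    (hA : Continuous A) (hB : Continuous B) (hA0 : ∀ t ∈ Icc (0:ℝ) 1, 0 ≤ A t)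
    (hB0 : ∀ t ∈ Icc (0:ℝ) 1, 0 ≤ B t)
    (hnum : ∀ᵐ t ∂(volume : Measure ℝ), t ∈ Ioo (0:ℝ) 1 →
      A t = Fvol n cn (α t) * gSpeed α t ^ (1 - p))
    (hden : ∀ᵐ t ∂(volume : Measure ℝ), t ∈ Ioo (0:ℝ) 1 →
      B t = Fvol n cn (α t) * gSpeed α t)
    (hF : ∀ t ∈ Icc (0:ℝ) 1, 0 ≤ Fvol n cn (α t))
    {f : ℝ → ℝ} (hf : Slope f) :
    lambdaG n cn p α * (∫ t in (0:ℝ)..1, primitive f t ^ p * B t) ≤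
      ∫ t in (0:ℝ)..1, f t ^ p * A t := by
  have hN0 : 0 ≤ ∫ t in (0:ℝ)..1, f t ^ p * A t :=
    intervalIntegral.integral_nonneg zero_le_one fun t ht =>
      mul_nonneg (Real.rpow_nonneg (hf.2.1 t) p) (hA0 t ht)
  have hD0 : 0 ≤ ∫ t in (0:ℝ)..1, primitive f t ^ p * B t :=
    intervalIntegral.integral_nonneg zero_le_one fun t ht =>
      mul_nonneg (Real.rpow_nonneg (hf.primitive_nonneg ht.1) p) (hB0 t ht)
  rcases hD0.eq_or_lt with h | hpos
  · rw [← h, mul_zero]; exact hN0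
  have hNeq : ∀ᵐ t ∂(volume : Measure ℝ), t ∈ Ioo (0:ℝ) 1 →
      f t ^ p * A t = numG n cn p (Icc 0 1) α (primitive f) t := by
    filter_upwards [hnum, hf.ae_derivWithin_primitive] with t h1 h2 hm
    simp only [numG]
    rw [h2 hm, abs_of_nonneg (hf.2.1 t), h1 hm, mul_assoc]; rfl
  have hDeq : ∀ᵐ t ∂(volume : Measure ℝ), t ∈ Ioo (0:ℝ) 1 →
      primitive f t ^ p * B t = denG n cn p (Icc 0 1) α (primitive f) t := by
    filter_upwards [hden] with t h1 hm
    simp only [denG]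
    rw [abs_of_nonneg (hf.primitive_nonneg hm.1.le), h1 hm, mul_assoc]; rfl
  rw [← le_div_iff₀ hpos]
  refine csInf_le ⟨0, ?_⟩ ⟨primitive f, hf.lipschitzOnWith_primitive, by simp [primitive],
    intervalIntegrable_congr_of_ae_Ioo (hf.intervalIntegrable_rpow_mul hA hp 0 1) hNeq,
    intervalIntegrable_congr_of_ae_Ioo (hf.intervalIntegrable_primitive_rpow_mul hB hp 0 1) hDeq,
    ?_, ?_⟩
  · rintro q ⟨w, -, -, -, -, hq, rfl⟩
    refine div_nonneg (intervalIntegral.integral_nonneg zero_le_one fun t ht => ?_) hq.le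
    exact mul_nonneg (mul_nonneg (Real.rpow_nonneg (abs_nonneg _) p) (hF t ht))
      (Real.rpow_nonneg (Real.sqrt_nonneg _) _)
  · rwa [← integral_congr_of_ae_Ioo hDeq]
  · rw [← integral_congr_of_ae_Ioo hDeq, ← integral_congr_of_ae_Ioo hNeq]

lemma lambdaG_set_nonempty {n : ℕ} {cn p : ℝ} {γ : ℝ → ℝ × ℝ} {S : ℝ → ℝ} {m M : ℝ} (hp : 1 ≤ p)
    (hF : Continuous fun t => Fvol n cn (γ (clampUnit t)))
    (hFpos : ∀ t ∈ Ioo (0:ℝ) 1, 0 < Fvol n cn (γ t)) (hS : Measurable S) (hm : 0 < m)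
    (hmS : ∀ t, m ≤ S t) (hSM : ∀ t, S t ≤ M)
    (hspeed : ∀ᵐ t ∂(volume : Measure ℝ), t ∈ Ioo (0:ℝ) 1 → gSpeed γ t = S t) :
    {q | ∃ w : ℝ → ℝ, (∃ K, LipschitzOnWith K w (Icc 0 1)) ∧ w 0 = 0 ∧
      IntervalIntegrable (numG n cn p (Icc 0 1) γ w) volume 0 1 ∧
      IntervalIntegrable (denG n cn p (Icc 0 1) γ w) volume 0 1 ∧
      (0 < ∫ t in (0:ℝ)..1, denG n cn p (Icc 0 1) γ w t) ∧
      q = (∫ t in (0:ℝ)..1, numG n cn p (Icc 0 1) γ w t) /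
        (∫ t in (0:ℝ)..1, denG n cn p (Icc 0 1) γ w t)}.Nonempty := by
  have hNeq : ∀ᵐ t ∂(volume : Measure ℝ), t ∈ Ioo (0:ℝ) 1 →
      S t ^ (1 - p) * Fvol n cn (γ (clampUnit t)) = numG n cn p (Icc 0 1) γ id t := by
    filter_upwards [hspeed] with t h1 hm
    simp only [numG]
    rw [derivWithin_Icc_eq_deriv hm, deriv_id, abs_one, Real.one_rpow, one_mul,
      clampUnit_of_mem (Ioo_subset_Icc_self hm), ← h1 hm, mul_comm]; rfl
  have hDeq : ∀ᵐ t ∂(volume : Measure ℝ), t ∈ Ioo (0:ℝ) 1 →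
      S t * (|t| ^ p * Fvol n cn (γ (clampUnit t))) = denG n cn p (Icc 0 1) γ id t := by
    filter_upwards [hspeed] with t h1 hm
    simp only [denG]
    rw [clampUnit_of_mem (Ioo_subset_Icc_self hm), ← h1 hm, mul_comm]; rfl
  have hSpos : ∀ t, 0 < S t := fun t => hm.trans_le (hmS t)
  have hiD : IntervalIntegrable (fun t => S t * (|t| ^ p * Fvol n cn (γ (clampUnit t))))
      volume 0 1 := by
    refine intervalIntegrable_mul_of_bounded (K := M) hS
      ((continuous_abs.rpow_const fun _ => Or.inr (by linarith)).mul hF) fun t _ => ?_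
    rw [abs_of_pos (hSpos t)]; exact hSM t
  refine ⟨_, id, ⟨1, LipschitzWith.id.lipschitzOnWith⟩, rfl,
    intervalIntegrable_congr_of_ae_Ioo ?_ hNeq, intervalIntegrable_congr_of_ae_Ioo hiD hDeq,
    ?_, rfl⟩
  · refine intervalIntegrable_mul_of_bounded (g := fun t => S t ^ (1 - p)) (K := m ^ (1 - p))
      (hS.pow_const _) hF fun t _ => ?_
    rw [abs_of_pos (Real.rpow_pos_of_pos (hSpos t) _)]
    exact Real.rpow_le_rpow_of_nonpos hm (hmS t) (by linarith)
  · rw [← integral_congr_of_ae_Ioo hDeq]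
    refine intervalIntegral.intervalIntegral_pos_of_pos_on hiD (fun t ht => ?_) zero_lt_one
    have h1 := hSpos t
    have h2 := hFpos t ht
    rw [clampUnit_of_mem (Ioo_subset_Icc_self ht), abs_of_pos ht.1]
    have h3 := Real.rpow_pos_of_pos ht.1 p
    positivity

/-- The Euclidean distance between two points of a curve. -/
def chord (α : ℝ → ℝ × ℝ) (s t : ℝ) : ℝ :=
  Real.sqrt (((α t).1 - (α s).1) ^ 2 + ((α t).2 - (α s).2) ^ 2)

lemma chord_comm (α : ℝ → ℝ × ℝ) (s t : ℝ) : chord α s t = chord α t s := by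
  unfold chord; congr 1; ring

lemma chord_pos {α : ℝ → ℝ × ℝ} {s t : ℝ} (h : α s ≠ α t) : 0 < chord α s t := by
  refine Real.sqrt_pos.2 ?_
  by_contra hle
  refine h (Prod.ext ?_ ?_) <;> nlinarith [sq_nonneg ((α t).1 - (α s).1),
    sq_nonneg ((α t).2 - (α s).2)]

lemma gSpeed_eq_of_hasDerivAt {γ : ℝ → ℝ × ℝ} {t u v : ℝ} (ht : t ∈ Ioo (0:ℝ) 1)
    (hu : HasDerivAt (fun s => (γ s).1) u t) (hv : HasDerivAt (fun s => (γ s).2) v t) :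
    gSpeed γ t = Real.sqrt (u ^ 2 + v ^ 2) := by
  unfold gSpeed gSpeedOn
  rw [derivWithin_Icc_eq_deriv ht, derivWithin_Icc_eq_deriv ht, hu.deriv, hv.deriv]

lemma gSpeed_congr {γ α : ℝ → ℝ × ℝ} {t : ℝ} (ht : t ∈ Ioo (0:ℝ) 1) (h : γ =ᶠ[𝓝 t] α) :
    gSpeed γ t = gSpeed α t := by
  unfold gSpeed gSpeedOn
  simp only [derivWithin_Icc_eq_deriv ht]
  have h1 : (fun u => (γ u).1) =ᶠ[𝓝 t] fun u => (α u).1 := h.fun_comp Prod.fst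
  have h2 : (fun u => (γ u).2) =ᶠ[𝓝 t] fun u => (α u).2 := h.fun_comp Prod.snd
  rw [h1.deriv_eq, h2.deriv_eq]

/-- A chord is no longer than the arc it spans. -/
lemma chord_le_of_speed {α : ℝ → ℝ × ℝ} {K : NNReal} {L : ℝ}
    (hα : LipschitzOnWith K α (Icc 0 1))
    (hL : ∀ᵐ t ∂(volume : Measure ℝ), t ∈ Icc (0:ℝ) 1 → gSpeed α t = L)
    {s t : ℝ} (hs : 0 ≤ s) (hst : s ≤ t) (ht : t ≤ 1) : chord α s t ≤ L * (t - s) := by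
  have hx := (LipschitzWith.prod_fst.comp_lipschitzOnWith hα).comp_clampUnit
  have hy := (LipschitzWith.prod_snd.comp_lipschitzOnWith hα).comp_clampUnit
  set x := (Prod.fst ∘ α) ∘ clampUnit with hxdef
  set y := (Prod.snd ∘ α) ∘ clampUnit with hydef
  have hcs : clampUnit s = s := clampUnit_of_mem ⟨hs, hst.trans ht⟩
  have hct : clampUnit t = t := clampUnit_of_mem ⟨hs.trans hst, ht⟩
  have hxi := hx.integral_deriv s t
  have hyi := hy.integral_deriv s t
  simp only [hxdef, hydef, Function.comp, hcs, hct] at hxi hyi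
  set dx := (α t).1 - (α s).1 with hdx
  set dy := (α t).2 - (α s).2 with hdy
  have hd2 : chord α s t ^ 2 = dx ^ 2 + dy ^ 2 := Real.sq_sqrt (by positivity)
  have hd0 : 0 ≤ chord α s t := Real.sqrt_nonneg _
  set d := chord α s t
  have hxI : IntervalIntegrable (deriv x) volume s t :=
    hx.lipschitzOnWith.absolutelyContinuousOnInterval.intervalIntegrable_deriv
  have hyI : IntervalIntegrable (deriv y) volume s t :=
    hy.lipschitzOnWith.absolutelyContinuousOnInterval.intervalIntegrable_deriv
  have hpt : ∀ᵐ u ∂(volume.restrict (Icc s t)), dx * deriv x u + dy * deriv y u ≤ d * L := by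
    rw [← restrict_Ioo_eq_restrict_Icc]
    refine (ae_restrict_iff' measurableSet_Ioo).2 ?_
    filter_upwards [hL] with u hu hm
    have hm' : u ∈ Ioo (0:ℝ) 1 := ⟨hs.trans_lt hm.1, hm.2.trans_le ht⟩
    have h1 := hu (Ioo_subset_Icc_self hm')
    unfold gSpeed gSpeedOn at h1
    rw [derivWithin_eq_deriv_comp_clampUnit hm', derivWithin_eq_deriv_comp_clampUnit hm'] at h1
    change Real.sqrt (deriv x u ^ 2 + deriv y u ^ 2) = L at h1
    have hL0 : 0 ≤ L := h1 ▸ Real.sqrt_nonneg _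
    have hL2 : L ^ 2 = deriv x u ^ 2 + deriv y u ^ 2 := by
      rw [← h1, Real.sq_sqrt (by positivity)]
    refine abs_le_of_sq_le_sq' ?_ (by positivity) |>.2
    rw [mul_pow, hd2, hL2]
    nlinarith [sq_nonneg (dx * deriv y u - dy * deriv x u)]
  have hint := intervalIntegral.integral_mono_ae_restrict hst
    ((hxI.const_mul dx).add (hyI.const_mul dy)) intervalIntegrable_const hpt
  rw [intervalIntegral.integral_add (hxI.const_mul dx) (hyI.const_mul dy),
    intervalIntegral.integral_const_mul, intervalIntegral.integral_const_mul,
    intervalIntegral.integral_const, smul_eq_mul] at hint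
  have hxi' : ∫ u in s..t, deriv x u = dx := hxi
  have hyi' : ∫ u in s..t, deriv y u = dy := hyi
  rw [hxi', hyi'] at hint
  rcases hd0.eq_or_lt with h | h
  · rw [← h]
    have hL0 : 0 ≤ L := by
      have : ∃ u, gSpeed α u = L := by
        have h2 : (volume : Measure ℝ).restrict (Icc (0:ℝ) 1) ≠ 0 := by
          rw [Ne, Measure.restrict_eq_zero]; simp
        have : NeBot (ae ((volume : Measure ℝ).restrict (Icc (0:ℝ) 1))) := ae_neBot.2 h2
        exact ((ae_restrict_iff' measurableSet_Icc).2 hL).exists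
      obtain ⟨u, hu⟩ := this
      exact hu ▸ Real.sqrt_nonneg _
    exact mul_nonneg hL0 (by linarith)
  · nlinarith

/-- The curve obtained from `α` by replacing the arc over `[a, b]` with its chord. -/
def chordCurve (α : ℝ → ℝ × ℝ) (a b t : ℝ) : ℝ × ℝ :=
  α (min t a) + ((max a (min b t) - a) * (b - a)⁻¹) • (α b - α a) + (α (max t b) - α b)

section chordCurve

variable {α : ℝ → ℝ × ℝ} {a b t : ℝ}

lemma chordCurve_of_le (hab : a < b) (ht : t ≤ a) : chordCurve α a b t = α t := by
  simp [chordCurve, ht, ht.trans hab.le]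

lemma chordCurve_of_ge (hab : a < b) (ht : b ≤ t) : chordCurve α a b t = α t := by
  have h : (b - a) * (b - a)⁻¹ = 1 := mul_inv_cancel₀ (sub_pos.2 hab).ne'
  simp [chordCurve, ht, hab.le, hab.le.trans ht, h]

lemma chordCurve_of_mem (ht : t ∈ Icc a b) :
    chordCurve α a b t = AffineMap.lineMap (α a) (α b) ((t - a) * (b - a)⁻¹) := by
  simp [chordCurve, ht.1, ht.2, AffineMap.lineMap_apply, add_comm]

lemma chordCurve_mem_of_convex {s : Set (ℝ × ℝ)} (hs : Convex ℝ s) (ha : α a ∈ s) (hb : α b ∈ s)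
    (hab : a < b) (ht : t ∈ Icc a b) : chordCurve α a b t ∈ s := by
  rw [chordCurve_of_mem ht]
  refine hs.lineMap_mem ha hb ⟨?_, ?_⟩
  · exact mul_nonneg (sub_nonneg.2 ht.1) (inv_nonneg.2 (sub_nonneg.2 hab.le))
  · rw [← div_eq_mul_inv, div_le_one (sub_pos.2 hab)]; linarith [ht.2]

lemma exists_lipschitzOnWith_chordCurve {K : NNReal} (hα : LipschitzOnWith K α (Icc 0 1))
    (ha : 0 ≤ a) (hb : b ≤ 1) :
    ∃ K', LipschitzOnWith K' (chordCurve α a b) (Icc 0 1) := by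
  have h1 : LipschitzOnWith (K * 1) (fun t => α (min t a)) (Icc 0 1) :=
    hα.comp (LipschitzWith.id.min_const a).lipschitzOnWith fun t ht =>
      ⟨le_min ht.1 ha, (min_le_left _ _).trans ht.2⟩
  have h3 : LipschitzOnWith (K * 1) (fun t => α (max t b)) (Icc 0 1) :=
    hα.comp (LipschitzWith.id.max_const b).lipschitzOnWith fun t ht =>
      ⟨le_max_of_le_left ht.1, max_le ht.2 hb⟩
  have h2 : LipschitzWith 1 fun t => max a (min b t) :=
    (LipschitzWith.id.const_min b).const_max a
  have h2' : LipschitzWith (‖α b - α a‖₊ * (‖(b - a)⁻¹‖₊ * 1))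
      fun t => ((max a (min b t) - a) * (b - a)⁻¹) • (α b - α a) := by
    refine LipschitzWith.of_dist_le_mul fun s t => ?_
    have := h2.dist_le_mul s t
    rw [dist_eq_norm, ← sub_smul, norm_smul, ← sub_mul, norm_mul, sub_sub_sub_cancel_right,
      ← dist_eq_norm]
    push_cast
    calc _ ≤ (((1 : NNReal) : ℝ) * dist s t) * ‖(b - a)⁻¹‖ * ‖α b - α a‖ := by gcongr
      _ = _ := by push_cast; ring
  have h4 : LipschitzWith 0 fun _ : ℝ => α b := LipschitzWith.const _
  exact ⟨_, (h1.add h2'.lipschitzOnWith).add (h3.sub h4.lipschitzOnWith)⟩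

lemma gSpeed_chordCurve_of_mem (ha : 0 ≤ a) (hab : a < b) (hb : b ≤ 1) (ht : t ∈ Ioo a b) :
    gSpeed (chordCurve α a b) t = chord α a b / (b - a) := by
  have hba : 0 < b - a := sub_pos.2 hab
  have hev : chordCurve α a b =ᶠ[𝓝 t]
      fun s => AffineMap.lineMap (α a) (α b) ((s - a) * (b - a)⁻¹) := by
    filter_upwards [Ioo_mem_nhds ht.1 ht.2] with s hs
    exact chordCurve_of_mem (Ioo_subset_Icc_self hs)
  have ht' : t ∈ Ioo (0:ℝ) 1 := ⟨ha.trans_lt ht.1, ht.2.trans_le hb⟩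
  have hd : ∀ u v : ℝ, HasDerivAt (fun s : ℝ => (s - a) * (b - a)⁻¹ * (v - u) + u)
      ((b - a)⁻¹ * (v - u)) t := fun u v => by
    simpa using
      ((((hasDerivAt_id t).sub_const a).mul_const (b - a)⁻¹).mul_const (v - u)).add_const u
  rw [gSpeed_congr ht' hev, gSpeed_eq_of_hasDerivAt ht' (u := (b - a)⁻¹ * ((α b).1 - (α a).1))
    (v := (b - a)⁻¹ * ((α b).2 - (α a).2))]
  · rw [chord, mul_pow, mul_pow, ← mul_add, Real.sqrt_mul (by positivity),
      Real.sqrt_sq (by positivity)]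
    ring
  · simpa [AffineMap.lineMap_apply] using hd (α a).1 (α b).1
  · simpa [AffineMap.lineMap_apply] using hd (α a).2 (α b).2

lemma ae_gSpeed_chordCurve {L : ℝ} (ha : 0 ≤ a) (hab : a < b) (hb : b ≤ 1)
    (hL : ∀ᵐ t ∂(volume : Measure ℝ), t ∈ Icc (0:ℝ) 1 → gSpeed α t = L) :
    ∀ᵐ t ∂(volume : Measure ℝ), t ∈ Ioo (0:ℝ) 1 → gSpeed (chordCurve α a b) t =
      (Icc a b).piecewise (fun _ => chord α a b / (b - a)) (fun _ => L) t := by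
  filter_upwards [hL, Measure.ae_ne volume a, Measure.ae_ne volume b] with t h1 hta htb hm
  by_cases ht : t ∈ Icc a b
  · rw [piecewise_eq_of_mem _ _ _ ht]
    exact gSpeed_chordCurve_of_mem ha hab hb
      ⟨lt_of_le_of_ne ht.1 hta.symm, lt_of_le_of_ne ht.2 htb⟩
  · rw [piecewise_eq_of_notMem _ _ _ ht, ← h1 (Ioo_subset_Icc_self hm)]
    refine gSpeed_congr hm ?_
    rcases lt_or_ge t a with h | h
    · filter_upwards [Iio_mem_nhds h] with s hs using chordCurve_of_le hab (le_of_lt hs)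
    · have h' : b < t := lt_of_not_ge fun h2 => ht ⟨h, h2⟩
      filter_upwards [Ioi_mem_nhds h'] with s hs using chordCurve_of_ge hab (le_of_lt hs)

end chordCurve

lemma continuous_Fvol (n : ℕ) (cn : ℝ) : Continuous (Fvol n cn) := by
  unfold Fvol; fun_prop

lemma Fvol_pos {n : ℕ} {cn : ℝ} (hcn : 0 < cn) {z : ℝ × ℝ} (hz : z ∈ Pint) : 0 < Fvol n cn z :=
  mul_pos (mul_pos hcn (pow_pos hz.1 _)) (pow_pos hz.2 _)

lemma convex_Pint : Convex ℝ Pint := by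
  have : Pint = Ioi 0 ×ˢ Ioi 0 := by ext; rfl
  rw [this]; exact (convex_Ioi 0).prod (convex_Ioi 0)

lemma MemRg.chordCurve {x0 y0 : ℝ} {α : ℝ → ℝ × ℝ} (hα : MemRg x0 y0 α) {a b : ℝ} (ha : 0 ≤ a)
    (hab : a < b) (hb : b < 1) : MemRg x0 y0 (chordCurve α a b) := by
  obtain ⟨⟨K, hK⟩, h0, h1, hint⟩ := hα
  refine ⟨exists_lipschitzOnWith_chordCurve hK ha hb.le, ?_, ?_, fun t ht => ?_⟩
  · rwa [chordCurve_of_le hab ha]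
  · rwa [chordCurve_of_ge hab hb.le]
  · rcases lt_or_ge t a with h | h
    · rw [chordCurve_of_le hab h.le]; exact hint t ht
    rcases lt_or_ge b t with h' | h'
    · rw [chordCurve_of_ge hab h'.le]; exact hint t ht
    · exact chordCurve_mem_of_convex convex_Pint (hint a ⟨ha, hab.trans hb⟩)
        (hint b ⟨ha.trans hab.le, hb⟩) hab ⟨h, h'⟩

lemma MemRg.continuous_Fvol {x0 y0 : ℝ} {α : ℝ → ℝ × ℝ} (hα : MemRg x0 y0 α) (n : ℕ) (cn : ℝ) :
    Continuous fun t => Fvol n cn (α (clampUnit t)) := by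
  obtain ⟨⟨K, hK⟩, -⟩ := hα
  exact (_root_.continuous_Fvol n cn).comp hK.comp_clampUnit.continuous

lemma MemRg.Fvol_nonneg {x0 y0 : ℝ} {α : ℝ → ℝ × ℝ} (hα : MemRg x0 y0 α) {n : ℕ} {cn : ℝ}
    (hcn : 0 < cn) {t : ℝ} (ht : t ∈ Icc (0:ℝ) 1) : 0 ≤ Fvol n cn (α t) := by
  obtain ⟨-, -, ⟨⟨h1, h2⟩, -⟩, hint⟩ := hα
  rcases ht.2.eq_or_lt with rfl | h
  · exact mul_nonneg (mul_nonneg hcn.le (pow_nonneg h1 _)) (pow_nonneg h2 _)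
  · exact (Fvol_pos hcn (hint t ⟨ht.1, h⟩)).le

lemma MemRgStar.Lg_pos {x0 y0 : ℝ} {α : ℝ → ℝ × ℝ} (hα : MemRgStar x0 y0 α) : 0 < Lg α := by
  obtain ⟨⟨⟨K, hK⟩, -⟩, hinj, hL, -⟩ := hα
  have h1 : α 0 ≠ α 1 := fun h => zero_ne_one (hinj (by simp) (by simp) h)
  have := chord_le_of_speed hK hL le_rfl zero_le_one le_rfl
  linarith [chord_pos h1]

lemma Fvol_eq_vcoord_pow (n : ℕ) (cn : ℝ) (z : ℝ × ℝ) :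
    Fvol n cn z = cn * vcoord z ^ (n - 1) := by
  unfold Fvol vcoord; rw [mul_pow, mul_assoc]

lemma lambdaG_pos {n : ℕ} {cn p c₀ L : ℝ} {α : ℝ → ℝ × ℝ} (hp : 1 ≤ p) (hL0 : 0 < L)
    (hF : Continuous fun t => Fvol n cn (α (clampUnit t)))
    (hF0 : ∀ t ∈ Icc (0:ℝ) 1, 0 ≤ Fvol n cn (α t))
    (hFpos : ∀ t ∈ Ioo (0:ℝ) 1, 0 < Fvol n cn (α t))
    (hL : ∀ᵐ t ∂(volume : Measure ℝ), t ∈ Ioo (0:ℝ) 1 → gSpeed α t = L) (hc₀ : 0 < c₀)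
    (hlow : ∀ f, Slope f → c₀ * primitive f 1 ^ p ≤
      ∫ t in (0:ℝ)..1, f t ^ p * (L ^ (1 - p) * Fvol n cn (α (clampUnit t)))) :
    0 < lambdaG n cn p α := by
  have hp0 : 0 ≤ p := zero_le_one.trans hp
  set B : ℝ → ℝ := fun t => L * Fvol n cn (α (clampUnit t)) with hBdef
  have hB : Continuous B := hF.const_mul L
  have hBn : ∀ t ∈ Icc (0:ℝ) 1, 0 ≤ B t := fun t ht =>
    mul_nonneg hL0.le (hF0 _ (clampUnit_mem t))
  have hBpos : 0 < ∫ t in (0:ℝ)..1, B t := by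
    refine intervalIntegral.intervalIntegral_pos_of_pos_on (hB.intervalIntegrable 0 1)
      (fun t ht => ?_) zero_lt_one
    simp only [hBdef, clampUnit_of_mem (Ioo_subset_Icc_self ht)]
    exact mul_pos hL0 (hFpos t ht)
  have hμ : 0 < c₀ / ∫ t in (0:ℝ)..1, B t := div_pos hc₀ hBpos
  refine hμ.trans_le (le_lambdaG (A := fun t => L ^ (1 - p) * Fvol n cn (α (clampUnit t)))
    hp0 hμ.le hB
    (lambdaG_set_nonempty hp hF hFpos measurable_const hL0 (fun _ => le_rfl) (fun _ => le_rfl) hL)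
    ?_ ?_ (fun f hf => hf.intervalIntegrable_rpow_mul (hF.const_mul _) hp0 0 1) fun f hf => ?_)
  · filter_upwards [hL] with t ht hm
    rw [clampUnit_of_mem (Ioo_subset_Icc_self hm), ht hm, mul_comm]
  · filter_upwards [hL] with t ht hm
    simp only [hBdef, clampUnit_of_mem (Ioo_subset_Icc_self hm), ht hm, mul_comm L]
    exact ⟨mul_nonneg (hFpos t hm).le hL0.le, le_rfl⟩
  · refine le_trans ?_ (hlow f hf)
    have hle : ∫ t in (0:ℝ)..1, primitive f t ^ p * B t ≤
        ∫ t in (0:ℝ)..1, primitive f 1 ^ p * B t := by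
      refine intervalIntegral.integral_mono_on zero_le_one
        (hf.intervalIntegrable_primitive_rpow_mul hB hp0 0 1)
        ((hB.const_mul _).intervalIntegrable 0 1) fun t ht => ?_
      exact mul_le_mul_of_nonneg_right (Real.rpow_le_rpow (hf.primitive_nonneg ht.1)
        (hf.primitive_mono ht.2) hp0) (hBn t ht)
    rw [intervalIntegral.integral_const_mul] at hle
    calc _ ≤ c₀ / (∫ t in (0:ℝ)..1, B t) * (primitive f 1 ^ p * ∫ t in (0:ℝ)..1, B t) :=
          mul_le_mul_of_nonneg_left hle hμ.le
      _ = _ := by field_simp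

/-- The Rayleigh inequality of a starred curve becomes strict, uniformly in the test function,
once the energy density is increased on a subinterval. -/
lemma MemRgStar.exists_gap {n : ℕ} (hn : 2 ≤ n) {cn : ℝ} (hcn : 0 < cn) {x0 y0 p : ℝ}
    (hp : 2 * (n : ℝ) - 1 ≤ p) {α : ℝ → ℝ × ℝ} (hα : MemRgStar x0 y0 α) {a b η : ℝ} (ha : 0 ≤ a)
    (hab : a < b) (hb : b < 1) (hη : 0 < η) :
    0 < lambdaG n cn p α ∧ ∃ σ > 1, ∀ f, Slope f →
      σ * (lambdaG n cn p α *
        ∫ t in (0:ℝ)..1, primitive f t ^ p * (Lg α * Fvol n cn (α (clampUnit t)))) ≤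
      (∫ t in (0:ℝ)..1, f t ^ p * (Lg α ^ (1 - p) * Fvol n cn (α (clampUnit t)))) +
        η * ∫ t in (0:ℝ)..1, (Icc a b).indicator 1 t * f t ^ p *
          (Lg α ^ (1 - p) * Fvol n cn (α (clampUnit t))) := by
  have hL0 := hα.Lg_pos
  obtain ⟨hR, -, hL, -, c, hc, hv⟩ := hα
  have hn' : (2:ℝ) ≤ n := by exact_mod_cast hn
  have hp2 : 2 ≤ p := by linarith
  have hF := hR.continuous_Fvol n cn
  have hF0 : ∀ t ∈ Icc (0:ℝ) 1, 0 ≤ Fvol n cn (α t) := fun t ht => hR.Fvol_nonneg hcn ht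
  have hFpos : ∀ t ∈ Ico (0:ℝ) 1, 0 < Fvol n cn (α t) := fun t ht => Fvol_pos hcn (hR.2.2.2 t ht)
  have hL' : ∀ᵐ t ∂(volume : Measure ℝ), t ∈ Ioo (0:ℝ) 1 → gSpeed α t = Lg α := by
    filter_upwards [hL] with t ht hm using ht (Ioo_subset_Icc_self hm)
  have hA0 : ∀ t ∈ Icc (0:ℝ) 1, 0 ≤ Lg α ^ (1 - p) * Fvol n cn (α (clampUnit t)) := fun t ht =>
    mul_nonneg (Real.rpow_nonneg hL0.le _) (hF0 _ (clampUnit_mem t))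
  have hB0 : ∀ t ∈ Icc (0:ℝ) 1, 0 ≤ Lg α * Fvol n cn (α (clampUnit t)) := fun t ht =>
    mul_nonneg hL0.le (hF0 _ (clampUnit_mem t))
  obtain ⟨c₀, hc₀, hlow⟩ := exists_energy_lower_bound (p := p) (k := n - 1)
    (c := Lg α ^ (1 - p) * (cn * c ^ (n - 1))) (hF.const_mul (Lg α ^ (1 - p))) (by positivity)
    (by push_cast [Nat.cast_sub (show 1 ≤ n by omega)]; linarith) (by linarith) fun t ht => by
      rw [clampUnit_of_mem ht, Fvol_eq_vcoord_pow, mul_assoc, mul_assoc, ← mul_pow]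
      have h1 : 0 ≤ c * (1 - t) := mul_nonneg hc.le (by linarith [ht.2])
      gcongr
      exact hv t ht
  have hl := lambdaG_pos (by linarith) hL0 hF hF0
    (fun t ht => hFpos t (Ioo_subset_Ico_self ht)) hL' hc₀ hlow
  refine ⟨hl, _root_.exists_gap (hF.const_mul _) (hF.const_mul _) hA0 hB0 (fun t ht => ?_) ha hab
    hb hp2 hc₀ hlow hη hl fun f hf => lambdaG_mul_le (by linarith) (hF.const_mul _) (hF.const_mul _)
    hA0 hB0 ?_ ?_ hF0 hf⟩
  · rw [clampUnit_of_mem (Ico_subset_Icc_self ht)]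
    exact mul_pos hL0 (hFpos t ht)
  · filter_upwards [hL'] with t ht hm
    rw [clampUnit_of_mem (Ioo_subset_Icc_self hm), ht hm, mul_comm]
  · filter_upwards [hL'] with t ht hm
    rw [clampUnit_of_mem (Ioo_subset_Icc_self hm), ht hm, mul_comm]

lemma numerator_gain {δ L s F₀ F₁ F₂ p : ℝ} (hδ : 0 < δ) (hδ1 : δ < 1) (hL : 0 < L) (hs : 0 < s)
    (hsL : s ≤ (1 - δ) * L) (hF₀ : 0 < F₀) (h1 : |F₁ - F₀| ≤ δ / 4 * F₀)
    (h2 : |F₂ - F₀| ≤ δ / 4 * F₀) (hp : 2 ≤ p) :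
    (1 + δ / 4) * (L ^ (1 - p) * F₁) ≤ F₂ * s ^ (1 - p) := by
  have hd : 0 < 1 - δ := by linarith
  rw [abs_le] at h1 h2
  have hs' : (1 - δ)⁻¹ * L ^ (1 - p) ≤ s ^ (1 - p) := by
    calc (1 - δ)⁻¹ * L ^ (1 - p) = (1 - δ) ^ (-1 : ℝ) * L ^ (1 - p) := by rw [Real.rpow_neg_one]
      _ ≤ (1 - δ) ^ (1 - p) * L ^ (1 - p) := by
          gcongr ?_ * _
          exact Real.rpow_le_rpow_of_exponent_ge hd (by linarith) (by linarith)
      _ = ((1 - δ) * L) ^ (1 - p) := (Real.mul_rpow hd.le hL.le).symm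
      _ ≤ s ^ (1 - p) := Real.rpow_le_rpow_of_nonpos hs hsL (by linarith)
  have hX : 0 < L ^ (1 - p) := Real.rpow_pos_of_pos hL _
  have hF₂ : 0 ≤ F₂ := by nlinarith
  have key : (1 + δ / 4) * F₁ ≤ F₂ * (1 - δ)⁻¹ := by
    rw [← div_eq_mul_inv, le_div_iff₀ hd]
    have h3 : (1 + δ / 4) * F₁ * (1 - δ) ≤ (1 + δ / 4) * ((1 + δ / 4) * F₀) * (1 - δ) := by
      gcongr; linarith
    have h4 : (1 + δ / 4) * (1 + δ / 4) * (1 - δ) ≤ 1 - δ / 4 := by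
      nlinarith [sq_nonneg δ, pow_pos hδ 3]
    nlinarith
  calc (1 + δ / 4) * (L ^ (1 - p) * F₁) = (1 + δ / 4) * F₁ * L ^ (1 - p) := by ring
    _ ≤ F₂ * (1 - δ)⁻¹ * L ^ (1 - p) := by gcongr
    _ = F₂ * ((1 - δ)⁻¹ * L ^ (1 - p)) := by ring
    _ ≤ _ := by gcongr

lemma denominator_loss {δ L s F₀ F₁ F₂ : ℝ} (hδ : 0 < δ) (hL : 0 < L) (hs : 0 < s)
    (hsL : s ≤ (1 - δ) * L) (hF₀ : 0 < F₀) (h1 : |F₁ - F₀| ≤ δ / 4 * F₀)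
    (h2 : |F₂ - F₀| ≤ δ / 4 * F₀) : F₂ * s ≤ L * F₁ := by
  rw [abs_le] at h1 h2
  calc F₂ * s ≤ ((1 + δ / 4) * F₀) * ((1 - δ) * L) := by
        refine mul_le_mul (by linarith) hsL hs.le (by positivity)
    _ ≤ L * ((1 - δ / 4) * F₀) := by
        have : (1 + δ / 4) * (1 - δ) ≤ 1 - δ / 4 := by nlinarith [sq_nonneg δ]
        nlinarith [mul_pos hL hF₀]
    _ ≤ _ := by gcongr; linarith

/-- Along a maximizer, a chord of an arc on which the weight is nearly constant cannot be much
shorter than the arc: otherwise cutting along the chord would increase the eigenvalue. -/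
lemma MemRgStar.mul_le_chord {n : ℕ} (hn : 2 ≤ n) {cn : ℝ} (hcn : 0 < cn) {x0 y0 p : ℝ}
    (hp : 2 * (n : ℝ) - 1 ≤ p) {α : ℝ → ℝ × ℝ} (hα : MemRgStar x0 y0 α)
    (hmax : ∀ γ : ℝ → ℝ × ℝ, MemRg x0 y0 γ → lambdaG n cn p γ ≤ lambdaG n cn p α)
    {a b δ F₀ : ℝ} (ha : 0 ≤ a) (hab : a < b) (hb : b < 1) (hδ : 0 < δ) (hδ1 : δ < 1)
    (hF₀ : 0 < F₀) (h1 : ∀ t ∈ Icc a b, |Fvol n cn (α t) - F₀| ≤ δ / 4 * F₀)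
    (h2 : ∀ t ∈ Icc a b, |Fvol n cn (chordCurve α a b t) - F₀| ≤ δ / 4 * F₀) :
    (1 - δ) * Lg α * (b - a) ≤ chord α a b := by
  by_contra! hshort
  have hba : 0 < b - a := sub_pos.2 hab
  have hn' : (2:ℝ) ≤ n := by exact_mod_cast hn
  have hp2 : 2 ≤ p := by linarith
  have hp0 : 0 ≤ p := by linarith
  have hL0 := hα.Lg_pos
  obtain ⟨hl, σ, hσ, hgap⟩ := hα.exists_gap hn hcn hp ha hab hb (η := δ / 4) (by positivity)
  have hRβ := hα.1.chordCurve ha hab hb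
  obtain ⟨hR, hinj, hL, -⟩ := hα
  have hspeed := ae_gSpeed_chordCurve ha hab hb.le hL
  set L := Lg α
  set s := chord α a b / (b - a) with hs_def
  have hs0 : 0 < s := div_pos (chord_pos fun h => hab.ne
    (hinj ⟨ha, (hab.trans hb).le⟩ ⟨ha.trans hab.le, hb.le⟩ h)) hba
  have hsL : s ≤ (1 - δ) * L := (div_lt_iff₀ hba).2 hshort |>.le
  set S : ℝ → ℝ := (Icc a b).piecewise (fun _ => s) (fun _ => L) with hS
  have hSin : ∀ t ∈ Icc a b, S t = s := fun t ht => piecewise_eq_of_mem _ _ _ ht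
  have hSout : ∀ t, t ∉ Icc a b → S t = L := fun t ht => piecewise_eq_of_notMem _ _ _ ht
  have hSmem : ∀ t, S t = s ∨ S t = L := fun t =>
    (em (t ∈ Icc a b)).imp (hSin t) (hSout t)
  have hβpos : ∀ t ∈ Ioo (0:ℝ) 1, 0 < Fvol n cn (chordCurve α a b t) := fun t ht =>
    Fvol_pos hcn (hRβ.2.2.2 t (Ioo_subset_Ico_self ht))
  have hβeq : ∀ t, t ∉ Icc a b → chordCurve α a b t = α t := fun t ht => by
    rcases lt_or_ge t a with h | h
    · exact chordCurve_of_le hab h.le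
    · exact chordCurve_of_ge hab (lt_of_not_ge fun h' => ht ⟨h, h'⟩).le
  have hF := hR.continuous_Fvol n cn
  have hA : Continuous fun t => L ^ (1 - p) * Fvol n cn (α (clampUnit t)) := hF.const_mul _
  have hsplit : ∀ f : ℝ → ℝ, (fun t => f t ^ p * ((1 + δ / 4 * (Icc a b).indicator 1 t) *
      (L ^ (1 - p) * Fvol n cn (α (clampUnit t))))) = fun t =>
      f t ^ p * (L ^ (1 - p) * Fvol n cn (α (clampUnit t))) + δ / 4 *
        ((Icc a b).indicator 1 t * f t ^ p * (L ^ (1 - p) * Fvol n cn (α (clampUnit t)))) :=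
    fun f => funext fun t => by ring
  have hle : σ * lambdaG n cn p α ≤ lambdaG n cn p (chordCurve α a b) := by
    refine le_lambdaG (A := fun t => (1 + δ / 4 * (Icc a b).indicator 1 t) *
        (L ^ (1 - p) * Fvol n cn (α (clampUnit t))))
      (B := fun t => L * Fvol n cn (α (clampUnit t))) hp0 (by positivity) (hF.const_mul L)
      (lambdaG_set_nonempty (S := S) (m := min s L) (M := max s L) (by linarith)
        (hRβ.continuous_Fvol n cn) hβpos
        (Measurable.piecewise measurableSet_Icc measurable_const measurable_const)
        (lt_min hs0 hL0) (fun t => ?_) (fun t => ?_) hspeed) ?_ ?_ (fun f hf => ?_) fun f hf => ?_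
    · rcases hSmem t with h | h <;> simp [h]
    · rcases hSmem t with h | h <;> simp [h]
    · filter_upwards [hspeed] with t ht hm
      rw [ht hm, clampUnit_of_mem (Ioo_subset_Icc_self hm)]
      by_cases htm : t ∈ Icc a b
      · rw [indicator_of_mem htm, hSin t htm, Pi.one_apply, mul_one]
        exact numerator_gain hδ hδ1 hL0 hs0 hsL hF₀ (h1 t htm) (h2 t htm) hp2
      · rw [indicator_of_notMem htm, hSout t htm, hβeq t htm, mul_zero,
          add_zero, one_mul, mul_comm]
    · filter_upwards [hspeed] with t ht hm
      rw [ht hm, clampUnit_of_mem (Ioo_subset_Icc_self hm)]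
      have hSpos : 0 ≤ S t := by rcases hSmem t with h | h <;> rw [h] <;> positivity
      refine ⟨mul_nonneg (hβpos t hm).le hSpos, ?_⟩
      by_cases htm : t ∈ Icc a b
      · rw [hSin t htm]
        exact denominator_loss hδ hL0 hs0 hsL hF₀ (h1 t htm) (h2 t htm)
      · rw [hSout t htm, hβeq t htm, mul_comm]
    · rw [hsplit]
      exact (hf.intervalIntegrable_rpow_mul hA hp0 0 1).add
        ((hf.intervalIntegrable_indicator_mul hA hp0 a b).const_mul _)
    · rw [hsplit, intervalIntegral.integral_add (hf.intervalIntegrable_rpow_mul hA hp0 0 1)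
        ((hf.intervalIntegrable_indicator_mul hA hp0 a b).const_mul _),
        intervalIntegral.integral_const_mul, mul_assoc]
      exact hgap f hf
  nlinarith [hmax _ hRβ]

/-- Near any interior time, chords of a maximizer are almost as long as the arcs they span. -/
lemma MemRgStar.eventually_mul_le_chord {n : ℕ} (hn : 2 ≤ n) {cn : ℝ} (hcn : 0 < cn)
    {x0 y0 p : ℝ} (hp : 2 * (n : ℝ) - 1 ≤ p) {α : ℝ → ℝ × ℝ} (hα : MemRgStar x0 y0 α)
    (hmax : ∀ γ : ℝ → ℝ × ℝ, MemRg x0 y0 γ → lambdaG n cn p γ ≤ lambdaG n cn p α)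
    {t0 δ : ℝ} (ht0 : t0 ∈ Ico (0:ℝ) 1) (hδ : 0 < δ) (hδ1 : δ < 1) :
    ∃ ρ > 0, ∀ a b, 0 ≤ a → a < b → b < 1 → |a - t0| < ρ → |b - t0| < ρ →
      (1 - δ) * Lg α * (b - a) ≤ chord α a b := by
  obtain ⟨K, hK⟩ := hα.1.1
  have hF₀ : 0 < Fvol n cn (α t0) := Fvol_pos hcn (hα.1.2.2.2 t0 ht0)
  obtain ⟨r, hr, hball⟩ := Metric.continuousAt_iff.1 (continuous_Fvol n cn).continuousAt
    (δ / 4 * Fvol n cn (α t0)) (by positivity)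
  obtain ⟨ρ, hρ, hαball⟩ := Metric.continuousWithinAt_iff.1
    (hK.continuousOn t0 (Ico_subset_Icc_self ht0)) r hr
  refine ⟨ρ, hρ, fun a b ha hab hb har hbr => ?_⟩
  have hmem : ∀ t ∈ Icc a b, α t ∈ Metric.ball (α t0) r := fun t ht =>
    hαball ⟨ha.trans ht.1, ht.2.trans hb.le⟩ (by
      rw [Real.dist_eq, abs_lt]
      exact ⟨by linarith [ht.1, (abs_lt.1 har).1], by linarith [ht.2, (abs_lt.1 hbr).2]⟩)
  refine hα.mul_le_chord hn hcn hp hmax ha hab hb hδ hδ1 hF₀ (fun t ht => ?_) fun t ht => ?_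
  · exact (hball (hmem t ht)).le
  · exact (hball (chordCurve_mem_of_convex (convex_ball _ _) (hmem a ⟨le_rfl, hab.le⟩)
      (hmem b ⟨hab.le, le_rfl⟩) hab ht)).le

/-- Chord-to-time ratios of a maximizer converge to its length. -/
lemma MemRgStar.exists_chord_div_near {n : ℕ} (hn : 2 ≤ n) {cn : ℝ} (hcn : 0 < cn)
    {x0 y0 p : ℝ} (hp : 2 * (n : ℝ) - 1 ≤ p) {α : ℝ → ℝ × ℝ} (hα : MemRgStar x0 y0 α)
    (hmax : ∀ γ : ℝ → ℝ × ℝ, MemRg x0 y0 γ → lambdaG n cn p γ ≤ lambdaG n cn p α)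
    {t0 ε : ℝ} (ht0 : t0 ∈ Ico (0:ℝ) 1) (hε : 0 < ε) :
    ∃ ρ > 0, ∀ a b, 0 ≤ a → a < b → b < 1 → |a - t0| < ρ → |b - t0| < ρ →
      dist (chord α a b / |b - a|) (Lg α) < ε := by
  have hL0 := hα.Lg_pos
  set δ := min (1 / 2) (ε / (2 * Lg α)) with hδ
  have hδ0 : 0 < δ := lt_min (by norm_num) (by positivity)
  obtain ⟨ρ, hρ, h⟩ := hα.eventually_mul_le_chord hn hcn hp hmax ht0 hδ0
    ((min_le_left _ _).trans_lt (by norm_num))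
  refine ⟨ρ, hρ, fun a b ha hab hb har hbr => ?_⟩
  have hba : 0 < b - a := sub_pos.2 hab
  have hlow := (le_div_iff₀ hba).2 (h a b ha hab hb har hbr)
  obtain ⟨⟨⟨K, hK⟩, -⟩, -, hL, -⟩ := hα
  have hup := (div_le_iff₀ hba).2 (chord_le_of_speed hK hL ha hab.le hb.le)
  have hδε : δ * Lg α ≤ ε / 2 := by
    calc δ * Lg α ≤ ε / (2 * Lg α) * Lg α := by gcongr; exact min_le_right _ _
      _ = ε / 2 := by field_simp
  rw [abs_of_pos hba, Real.dist_eq, abs_lt]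
  constructor <;> linarith

/-- (Absolute differentiability.) Let `α ∈ R_g^*` maximize
`λ_{1,p}` over `R_g` (`p ≥ 2n-1`). For `t₀ ∈ [0,1)`, sequences `p_k ∈ [0,t₀]`
and `q_k ∈ [t₀,1)` converging to `t₀` with `p_k ≠ q_k`, the difference quotients
`|α(q_k) - α(p_k)|/|q_k - p_k|` converge to `L_g(α)`; in particular
`|α(t) - α(t₀)|/|t - t₀| → L_g(α)` as `t → t₀`. -/
theorem simons_stmt16 (n : ℕ) (hn : 2 ≤ n) (cn : ℝ) (hcn : 0 < cn)
    (x0 y0 : ℝ) (hy0 : 0 < y0) (hxy : y0 ≤ x0)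
    (p : ℝ) (hp : 2 * (n : ℝ) - 1 ≤ p)
    (α : ℝ → ℝ × ℝ) (hα : MemRgStar x0 y0 α)
    (hmax : ∀ γ : ℝ → ℝ × ℝ, MemRg x0 y0 γ → lambdaG n cn p γ ≤ lambdaG n cn p α)
    (t0 : ℝ) (ht0 : t0 ∈ Ico (0:ℝ) 1)
    (pk qk : ℕ → ℝ) (hpk : ∀ k, pk k ∈ Icc 0 t0) (hqk : ∀ k, qk k ∈ Ico t0 1)
    (hpklim : Tendsto pk atTop (𝓝 t0)) (hqklim : Tendsto qk atTop (𝓝 t0))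
    (hne : ∀ k, pk k ≠ qk k) :
    Tendsto (fun k =>
        Real.sqrt (((α (qk k)).1 - (α (pk k)).1) ^ 2 +
          ((α (qk k)).2 - (α (pk k)).2) ^ 2) / |qk k - pk k|)
      atTop (𝓝 (Lg α)) ∧
    Tendsto (fun t =>
        Real.sqrt (((α t).1 - (α t0).1) ^ 2 + ((α t).2 - (α t0).2) ^ 2) / |t - t0|)
      (𝓝[Icc 0 1 \ {t0}] t0) (𝓝 (Lg α)) := by
  refine ⟨Metric.tendsto_atTop'.2 fun ε hε => ?_, Metric.tendsto_nhdsWithin_nhds.2 fun ε hε => ?_⟩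
  · obtain ⟨ρ, hρ, h⟩ := hα.exists_chord_div_near hn hcn hp hmax ht0 hε
    obtain ⟨N, hN⟩ := eventually_atTop.1
      ((Metric.tendsto_nhds.1 hpklim ρ hρ).and (Metric.tendsto_nhds.1 hqklim ρ hρ))
    refine ⟨N, fun k hk => h (pk k) (qk k) (hpk k).1 ?_ (hqk k).2 (hN k hk.le).1 (hN k hk.le).2⟩
    exact lt_of_le_of_ne ((hpk k).2.trans (hqk k).1) (hne k)
  · obtain ⟨ρ, hρ, h⟩ := hα.exists_chord_div_near hn hcn hp hmax ht0 hε
    refine ⟨min ρ (1 - t0), lt_min hρ (sub_pos.2 ht0.2), fun t ht hd => ?_⟩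
    obtain ⟨hdρ, hd1⟩ := lt_min_iff.1 hd
    have h0 : |t0 - t0| < ρ := by simpa using hρ
    have ht1 : t < 1 := by linarith [le_abs_self (t - t0), Real.dist_eq t t0]
    rcases lt_or_gt_of_ne ht.2 with hlt | hlt
    · have := h t t0 ht.1.1 hlt ht0.2 hdρ h0
      rwa [chord_comm, abs_sub_comm] at this
    · exact h t0 t ht0.1 hlt ht1 h0 hdρ
end
end
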